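/- arXiv:1109.6395 — 3 statements merged into one kernel-verified Lean document; each statement's English description precedes it below -/
import Mathlib

section
/- For every ω ∈ D, every Schwartz function f on ℝ², and every x ∈ ℝ²: f * m_ω(x) = lim_{N→∞} (1/(4N²))·∫_{[−N,N]²} Σ_{s∈U_ω} ⟨f, φ_s(p + ·)⟩·φ_s(p + x) dp, where m_ω is the inverse Fourier transform of m̂_ω and φ_s(p + ·) denotes the translated wave packet y ↦ φ_s(p + y). -/
open MeasureTheory Set Filter
open scoped Classical

noncomputable section

namespace Bateman

/-- A tile: frequency scale `l` (the frequency interval has length `2^{-l}`), frequency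
position `m` (the interval is `[m·2^{-l}, (m+1)·2^{-l})`, contained in `[-2,2]`),
spatial dyadic position `n` (the `x`-projection is `[n·w·2^l, (n+1)·w·2^l)`) and
vertical position `k`. -/
structure Tile where
  l : ℕ
  m : ℤ
  n : ℤ
  k : ℤ
  hlo : (-2 : ℝ) ≤ (m : ℝ) * (2:ℝ) ^ (-(l:ℤ))
  hhi : ((m : ℝ) + 1) * (2:ℝ) ^ (-(l:ℤ)) ≤ 2

noncomputable instance : DecidableEq Tile := Classical.decEq _

namespace Tile

/-- Length of the frequency interval of a tile. -/
def freqLen (s : Tile) : ℝ := (2:ℝ) ^ (-(s.l:ℤ))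

/-- Frequency interval `ω_s`. -/
def ω (s : Tile) : Set ℝ := Ico ((s.m : ℝ) * s.freqLen) (((s.m : ℝ) + 1) * s.freqLen)

/-- Center of `ω_s`; this is the slope of the long side of the tile. -/
def slope (s : Tile) : ℝ := ((s.m : ℝ) + 1/2) * s.freqLen

/-- Right half `ω_{s,1}` of `ω_s`. -/
def ω1 (s : Tile) : Set ℝ := Ico s.slope (((s.m : ℝ) + 1) * s.freqLen)

/-- Left half `ω_{s,2}` of `ω_s`. -/
def ω2 (s : Tile) : Set ℝ := Ico ((s.m : ℝ) * s.freqLen) s.slope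

/-- Length `L(s) = w·2^l` of the tile. -/
def len (w : ℝ) (s : Tile) : ℝ := w * 2 ^ s.l

/-- The spatial parallelogram of the tile: two vertical sides of length `w`, two long
sides of slope `c(ω_s)` and length `w·2^l`, `x`-projection a dyadic interval. -/
def rect (w : ℝ) (s : Tile) : Set (ℝ × ℝ) :=
  {p | p.1 ∈ Ico ((s.n : ℝ) * s.len w) (((s.n : ℝ) + 1) * s.len w) ∧
       p.2 - s.slope * p.1 ∈ Ico ((s.k : ℝ) * w) (((s.k : ℝ) + 1) * w)}

/-- Area `|s| = w²·2^l` of the tile. -/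
def area (w : ℝ) (s : Tile) : ℝ := w ^ 2 * 2 ^ s.l

/-- Center of the tile. -/
def center (w : ℝ) (s : Tile) : ℝ × ℝ :=
  (((s.n : ℝ) + 1/2) * s.len w,
   s.slope * (((s.n : ℝ) + 1/2) * s.len w) + ((s.k : ℝ) + 1/2) * w)

/-- Dilate `C·s` of the tile by a factor `C` about its center. -/
def dilate (w C : ℝ) (s : Tile) : Set (ℝ × ℝ) :=
  (fun p => s.center w + C • (p - s.center w)) '' s.rect w

/-- Order on tiles: `s ≤ s'` iff `s ⊆ 10·s'` and `ω_{s'} ⊆ ω_s`. -/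
def le (w : ℝ) (s s' : Tile) : Prop := s.rect w ⊆ s'.dilate w 10 ∧ s'.ω ⊆ s.ω

/-- The affine map taking the tile onto the unit square centered at the origin. -/
def unitMap (w : ℝ) (s : Tile) (p : ℝ × ℝ) : ℝ × ℝ :=
  ((p.1 - ((s.n : ℝ) + 1/2) * s.len w) / s.len w,
   (p.2 - s.slope * p.1 - ((s.k : ℝ) + 1/2) * w) / w)

end Tile

/-- The weight `χ(x) = (1 + |x|^{100})⁻¹` on `ℝ²`. -/
def chi (p : ℝ × ℝ) : ℝ := (1 + (p.1 ^ 2 + p.2 ^ 2) ^ (50:ℕ))⁻¹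

/-- `χ_s^{(1)} = |s|⁻¹·χ∘A_s`, the `L¹`-normalized version of `χ` adapted to the tile. -/
def chi1 (w : ℝ) (s : Tile) (p : ℝ × ℝ) : ℝ := (s.area w)⁻¹ * chi (s.unitMap w p)

/-- The density `dense(s) = ∫_{E_s} χ_s^{(1)}` where `E_s = {(x,y) ∈ E : u(x) ∈ ω_s}`. -/
def dens (w : ℝ) (u : ℝ → ℝ) (E : Set (ℝ × ℝ)) (s : Tile) : ℝ :=
  ∫ p in {p ∈ E | u p.1 ∈ s.ω}, chi1 w s p

/-- The upward density `udense(s) = sup{dense(s') : s ≤ s'}`. -/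
def udens (w : ℝ) (u : ℝ → ℝ) (E : Set (ℝ × ℝ)) (s : Tile) : ℝ :=
  sSup {x | ∃ s' : Tile, Tile.le w s s' ∧ x = dens w u E s'}

/-- `e(t) = exp(2πit)`. -/
def e (t : ℝ) : ℂ := Complex.exp (Complex.I * ((2 * Real.pi * t : ℝ) : ℂ))

/-- The multiplier `m̂_ω(ξ,η) = β̃(wη)·β_ω(ξ/η)` of a tile, where
`β_ω(x) = β(2^{l+c}(x − c(ω₁)))` and `c(ω₁) = (m + 3/4)·2^{-l}` is the center of the
right half of `ω`. -/
def mhat (β βt : ℝ → ℝ) (cc : ℕ) (w : ℝ) (s : Tile) (ξ : ℝ × ℝ) : ℝ :=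
  βt (w * ξ.2) * β ((2:ℝ) ^ (s.l + cc) * (ξ.1 / ξ.2 - ((s.m : ℝ) + 3/4) * s.freqLen))

/-- `φ_ω`, the inverse Fourier transform of `(m̂_ω)^{1/2}`. -/
def φω (β βt : ℝ → ℝ) (cc : ℕ) (w : ℝ) (s : Tile) (x : ℝ × ℝ) : ℂ :=
  ∫ ξ : ℝ × ℝ, e (x.1 * ξ.1 + x.2 * ξ.2) * ((Real.sqrt (mhat β βt cc w s ξ) : ℝ) : ℂ)

/-- The `L²`-normalized wave packet `φ_s(p) = |s|^{1/2}·φ_ω(p − c(s))`. -/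
def wp (β βt : ℝ → ℝ) (cc : ℕ) (w : ℝ) (s : Tile) (p : ℝ × ℝ) : ℂ :=
  ((Real.sqrt (s.area w) : ℝ) : ℂ) * φω β βt cc w s (p - s.center w)

/-- `⟨f,g⟩ = ∫ f·conj g`. -/
def inn (f g : ℝ × ℝ → ℂ) : ℂ := ∫ p : ℝ × ℝ, f p * (starRingEnd ℂ) (g p)

/-- The inverse Fourier transform of `ψ_s(θ) = ψ(L(s)·θ)`. -/
def psiCheck (ψ : ℝ → ℝ) (w : ℝ) (s : Tile) (t : ℝ) : ℂ :=
  ∫ θ : ℝ, e (t * θ) * ((ψ (s.len w * θ) : ℝ) : ℂ)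

/-- The transformed wave packet
`phi_s(x₁,x₂) = ∫ ψ̌_s(t)·φ_s(x₁ − t, x₂ − t·u(x₁)) dt`. -/
def phiT (β βt ψ : ℝ → ℝ) (cc : ℕ) (w : ℝ) (u : ℝ → ℝ) (s : Tile) (x : ℝ × ℝ) : ℂ :=
  ∫ t : ℝ, psiCheck ψ w s t * wp β βt cc w s (x.1 - t, x.2 - t * u x.1)

/-- Hypotheses on the bump function `β`: smooth, `[0,1]`-valued, `1` on `[-1,1]`,
vanishing outside `[-2,2]`, with smooth square root. -/
def IsBumpβ (β : ℝ → ℝ) : Prop :=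
  ContDiff ℝ (⊤ : ℕ∞) β ∧ (∀ x, β x ∈ Icc (0:ℝ) 1) ∧ (∀ x ∈ Icc (-1:ℝ) 1, β x = 1) ∧
  (∀ x : ℝ, 2 ≤ |x| → β x = 0) ∧ ContDiff ℝ (⊤ : ℕ∞) (fun x => Real.sqrt (β x))

/-- Hypotheses on the bump function `β̃`: smooth, `[0,1]`-valued, supported in
`[1/2,5/2]` and equal to `1` on `[1,2]`. -/
def IsBumpβt (βt : ℝ → ℝ) : Prop :=
  ContDiff ℝ (⊤ : ℕ∞) βt ∧ (∀ x, βt x ∈ Icc (0:ℝ) 1) ∧ (∀ x ∈ Icc (1:ℝ) 2, βt x = 1) ∧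
  (∀ x : ℝ, x ∉ Icc (1/2 : ℝ) (5/2) → βt x = 0)

/-- Hypotheses on the bump function `ψ`: smooth, `[0,1]`-valued, supported in
`[98/100, 102/100]` and equal to `1` on `[99/100, 101/100]`. -/
def IsBumpψ (ψ : ℝ → ℝ) : Prop :=
  ContDiff ℝ (⊤ : ℕ∞) ψ ∧ (∀ x, ψ x ∈ Icc (0:ℝ) 1) ∧
  (∀ x ∈ Icc (99/100 : ℝ) (101/100), ψ x = 1) ∧
  (∀ x : ℝ, x ∉ Icc (98/100 : ℝ) (102/100) → ψ x = 0)

/-- A tree: a finite set of tiles together with a top tile. -/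
structure Tree where
  tiles : Finset Tile
  top : Tile

/-- `T` is a tree: every tile of `T` lies below the top. -/
def Tree.IsTree (w : ℝ) (T : Tree) : Prop := ∀ s ∈ T.tiles, Tile.le w s T.top

/-- `T` is a `1`-tree: moreover `ω_{top(T)} ∩ ω_{s,1} = ∅` for all `s ∈ T`. -/
def Tree.IsOneTree (w : ℝ) (T : Tree) : Prop :=
  T.IsTree w ∧ ∀ s ∈ T.tiles, T.top.ω ∩ s.ω1 = ∅

/-- The maximal `1`-subtree `T₁` of a tree `T`. -/
def Tree.oneTiles (T : Tree) : Finset Tile :=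
  T.tiles.filter fun s => T.top.ω ∩ s.ω1 = ∅

/-- `(1/|top(T)|)·Σ_{s∈T}|⟨f,φ_s⟩|²`. -/
def energy (β βt : ℝ → ℝ) (cc : ℕ) (w : ℝ) (f : ℝ × ℝ → ℂ) (T : Tree) : ℝ :=
  (T.top.area w)⁻¹ * ∑ s ∈ T.tiles, ‖inn f (wp β βt cc w s)‖ ^ 2

/-- The size of a finite collection of tiles with respect to the set `F`:
the supremum over `1`-trees `T ⊆ S` of `(|top(T)|⁻¹·Σ_{s∈T}|⟨1_F,φ_s⟩|²)^{1/2}`. -/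
def size (β βt : ℝ → ℝ) (cc : ℕ) (w : ℝ) (F : Set (ℝ × ℝ)) (S : Finset Tile) : ℝ :=
  sSup (insert 0 {x | ∃ T : Tree, T.IsOneTree w ∧ T.tiles ⊆ S ∧
    x = Real.sqrt (energy β βt cc w (F.indicator fun _ => (1:ℂ)) T)})


/-- The function `m_ω`, the inverse Fourier transform of `m̂_ω`. -/
def mInv (β βt : ℝ → ℝ) (cc : ℕ) (w : ℝ) (s : Tile) (x : ℝ × ℝ) : ℂ :=
  ∫ ξ : ℝ × ℝ, e (x.1 * ξ.1 + x.2 * ξ.2) * ((mhat β βt cc w s ξ : ℝ) : ℂ)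

section Plancherel

open scoped FourierTransform

lemma fourier_continuous {V : Type*} [NormedAddCommGroup V] [InnerProductSpace ℝ V]
    [MeasurableSpace V] [BorelSpace V] [FiniteDimensional ℝ V] {g : V → ℂ}
    (hg : Integrable g) : Continuous (𝓕 g) :=
  VectorFourier.fourierIntegral_continuous Real.continuous_fourierChar
    (by exact continuous_inner) hg

lemma fourier_ae_eq_Lp {V : Type*} [NormedAddCommGroup V] [InnerProductSpace ℝ V]
    [MeasurableSpace V] [BorelSpace V] [FiniteDimensional ℝ V] {g : V → ℂ}
    (hg : Integrable g) (hg2 : MemLp g 2) :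
    𝓕 g =ᵐ[volume] ((𝓕 (hg2.toLp g) : Lp (α := V) ℂ 2 volume) : V → ℂ) := by
  apply ae_eq_of_integral_contDiff_smul_eq
  · exact (fourier_continuous hg).locallyIntegrable
  · exact (Lp.memLp (𝓕 (hg2.toLp g) : Lp (α := V) ℂ 2 volume)).locallyIntegrable (by norm_num)
  intro θ hθ hc
  have h₁ : HasCompactSupport (Complex.ofRealCLM ∘ θ) := hc.comp_left rfl
  have h₂ : ContDiff ℝ (⊤ : ℕ∞) (Complex.ofRealCLM ∘ θ) := Complex.ofRealCLM.contDiff.comp hθ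
  set Θ := h₁.toSchwartzMap h₂ with hΘ
  have hΘa : ∀ x, Θ x = (θ x : ℂ) := fun x => rfl
  have key := congrArg (fun T => T Θ) (Lp.fourier_toTemperedDistribution_eq (hg2.toLp g))
  simp only [TemperedDistribution.fourier_apply, Lp.toTemperedDistribution_apply] at key
  have e1 : ∫ x, θ x • ((𝓕 (hg2.toLp g) : Lp (α := V) ℂ 2 volume) : V → ℂ) x
      = ∫ x, (𝓕 Θ) x • ((hg2.toLp g) : V → ℂ) x := by
    rw [key]; rfl
  have e2 : ∫ x, (𝓕 Θ) x • ((hg2.toLp g) : V → ℂ) x = ∫ x, (𝓕 Θ) x • g x := by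
    apply integral_congr_ae
    filter_upwards [hg2.coeFn_toLp] with x hx
    rw [hx]
  rw [e1, e2]
  have := VectorFourier.integral_fourierIntegral_smul_eq_flip (e := Real.fourierChar)
    (L := innerₗ V) (μ := volume) (ν := volume) (f := (Θ : V → ℂ)) (g := g)
    Real.continuous_fourierChar (by exact continuous_inner) Θ.integrable hg
  rw [flip_innerₗ] at this
  rw [SchwartzMap.fourier_coe]
  exact this.symm

lemma memLp_fourier {V : Type*} [NormedAddCommGroup V] [InnerProductSpace ℝ V]
    [MeasurableSpace V] [BorelSpace V] [FiniteDimensional ℝ V] {g : V → ℂ}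
    (hg : Integrable g) (hg2 : MemLp g 2) : MemLp (𝓕 g) 2 :=
  (memLp_congr_ae (fourier_ae_eq_Lp hg hg2)).2 (Lp.memLp _)

lemma integral_conj_fourier_mul_fourier {V : Type*} [NormedAddCommGroup V] [InnerProductSpace ℝ V]
    [MeasurableSpace V] [BorelSpace V] [FiniteDimensional ℝ V] {g h : V → ℂ}
    (hg : Integrable g) (hg2 : MemLp g 2) (hh : Integrable h) (hh2 : MemLp h 2) :
    ∫ x, starRingEnd ℂ (𝓕 g x) * 𝓕 h x = ∫ x, starRingEnd ℂ (g x) * h x := by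
  have := Lp.inner_fourier_eq (hg2.toLp g) (hh2.toLp h)
  rw [L2.inner_def, L2.inner_def] at this
  convert! this using 1
  · apply integral_congr_ae
    filter_upwards [fourier_ae_eq_Lp hg hg2, fourier_ae_eq_Lp hh hh2] with x h1 h2
    rw [h1, h2, RCLike.inner_apply, mul_comm]
  · apply integral_congr_ae
    filter_upwards [hg2.coeFn_toLp, hh2.coeFn_toLp] with x h1 h2
    rw [h1, h2, RCLike.inner_apply, mul_comm]

lemma continuous_e : Continuous e := by unfold e; fun_prop

lemma norm_e (t : ℝ) : ‖e t‖ = 1 := by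
  rw [e, mul_comm]; exact Complex.norm_exp_ofReal_mul_I _

lemma e_add (s t : ℝ) : e (s + t) = e s * e t := by
  simp only [e]; rw [← Complex.exp_add]; congr 1; push_cast; ring

lemma e_neg (t : ℝ) : e (-t) = starRingEnd ℂ (e t) := by
  simp only [e]; rw [← Complex.exp_conj, map_mul, Complex.conj_I, Complex.conj_ofReal]; congr 1; push_cast; ring

lemma fourierChar_eq_e (t : ℝ) : (Real.fourierChar t : ℂ) = e t := by
  rw [Real.fourierChar_apply, e, mul_comm]

/-- The inverse Fourier transform of a function on `ℝ × ℝ`. -/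
def invFT (g : ℝ × ℝ → ℂ) (x : ℝ × ℝ) : ℂ :=
  ∫ ξ : ℝ × ℝ, e (x.1 * ξ.1 + x.2 * ξ.2) * g ξ

lemma fourier_toLp_eq_invFT (g : ℝ × ℝ → ℂ) (x : WithLp 2 (ℝ × ℝ)) :
    𝓕 (fun v : WithLp 2 (ℝ × ℝ) => g v.ofLp) x = invFT g (-x.ofLp) := by
  rw [Real.fourier_eq, invFT, ← (WithLp.volume_preserving_ofLp ℝ ℝ).integral_comp
    (MeasurableEquiv.toLp 2 (ℝ × ℝ)).symm.measurableEmbedding]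
  congr 1 with v
  rw [Circle.smul_def, fourierChar_eq_e, smul_eq_mul]
  congr 2
  simp [WithLp.prod_inner_apply]
  ring

lemma invFT_eq (g : ℝ × ℝ → ℂ) (x : ℝ × ℝ) :
    invFT g x = 𝓕 (fun v : WithLp 2 (ℝ × ℝ) => g v.ofLp) (WithLp.toLp 2 (-x)) := by
  rw [fourier_toLp_eq_invFT]; simp

lemma integrable_comp_ofLp {g : ℝ × ℝ → ℂ} (hg : Integrable g) :
    Integrable (fun v : WithLp 2 (ℝ × ℝ) => g v.ofLp) :=
  (WithLp.volume_preserving_ofLp ℝ ℝ).integrable_comp_of_integrable hg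

lemma memLp_comp_ofLp {g : ℝ × ℝ → ℂ} (hg : MemLp g 2) :
    MemLp (fun v : WithLp 2 (ℝ × ℝ) => g v.ofLp) 2 :=
  hg.comp_measurePreserving (WithLp.volume_preserving_ofLp ℝ ℝ)

lemma continuous_invFT {g : ℝ × ℝ → ℂ} (hg : Integrable g) : Continuous (invFT g) := by
  rw [show invFT g = _ from funext (invFT_eq g)]
  exact (fourier_continuous (integrable_comp_ofLp hg)).comp
    ((WithLp.prod_continuous_toLp 2 ℝ ℝ).comp continuous_neg)

lemma memLp_invFT {g : ℝ × ℝ → ℂ} (hg : Integrable g) (hg2 : MemLp g 2) :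
    MemLp (invFT g) 2 := by
  rw [show invFT g = _ from funext (invFT_eq g)]
  exact (memLp_fourier (integrable_comp_ofLp hg) (memLp_comp_ofLp hg2)).comp_measurePreserving
    ((WithLp.volume_preserving_toLp ℝ ℝ).comp (Measure.measurePreserving_neg volume))

lemma integral_conj_invFT_mul_invFT {g h : ℝ × ℝ → ℂ}
    (hg : Integrable g) (hg2 : MemLp g 2) (hh : Integrable h) (hh2 : MemLp h 2) :
    ∫ x, starRingEnd ℂ (invFT g x) * invFT h x = ∫ x, starRingEnd ℂ (g x) * h x := by
  have := integral_conj_fourier_mul_fourier (integrable_comp_ofLp hg) (memLp_comp_ofLp hg2)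
    (integrable_comp_ofLp hh) (memLp_comp_ofLp hh2)
  simp only [fourier_toLp_eq_invFT] at this
  rw [(WithLp.volume_preserving_ofLp ℝ ℝ).integral_comp
      (MeasurableEquiv.toLp 2 (ℝ × ℝ)).symm.measurableEmbedding
      (fun x => starRingEnd ℂ (invFT g (-x)) * invFT h (-x)),
    (WithLp.volume_preserving_ofLp ℝ ℝ).integral_comp
      (MeasurableEquiv.toLp 2 (ℝ × ℝ)).symm.measurableEmbedding
      (fun x => starRingEnd ℂ (g x) * h x)] at this
  rw [← this]
  exact (integral_neg_eq_self (fun x => starRingEnd ℂ (invFT g x) * invFT h x) volume).symm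

lemma conj_invFT (g : ℝ × ℝ → ℝ) (x : ℝ × ℝ) :
    starRingEnd ℂ (invFT (fun ξ => (g ξ : ℂ)) x) = invFT (fun ξ => (g ξ : ℂ)) (-x) := by
  rw [invFT, ← integral_conj, invFT]
  congr 1 with ξ
  rw [map_mul, ← e_neg, Complex.conj_ofReal]
  congr 2
  simp only [Prod.fst_neg, Prod.snd_neg]; ring

lemma integral_invFT_mul_invFT_sub {g : ℝ × ℝ → ℝ}
    (hg : Integrable (fun ξ => (g ξ : ℂ))) (hg2 : MemLp (fun ξ => (g ξ : ℂ)) 2) (v : ℝ × ℝ) :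
    ∫ u, invFT (fun ξ => (g ξ : ℂ)) u * invFT (fun ξ => (g ξ : ℂ)) (v - u)
      = invFT (fun ξ => ((g ξ ^ 2 : ℝ) : ℂ)) v := by
  set m : ℝ × ℝ → ℂ := fun ξ => e (v.1 * ξ.1 + v.2 * ξ.2) with hm
  have hmc : Continuous m := continuous_e.comp (by fun_prop)
  have hmn : ∀ ξ, ‖m ξ‖ = 1 := fun ξ => norm_e _
  set h : ℝ × ℝ → ℂ := fun ξ => m ξ * g ξ with hh
  have hhm : AEStronglyMeasurable h := hmc.aestronglyMeasurable.mul hg.aestronglyMeasurable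
  have hhn : ∀ ξ, ‖h ξ‖ = ‖(g ξ : ℂ)‖ := fun ξ => by rw [hh, norm_mul, hmn, one_mul]
  have hi : Integrable h := hg.congr' hhm (Eventually.of_forall fun ξ => (hhn ξ).symm)
  have hi2 : MemLp h 2 := hg2.congr_norm hhm (Eventually.of_forall fun ξ => (hhn ξ).symm)
  have hinv : ∀ u, invFT h u = invFT (fun ξ => (g ξ : ℂ)) (v + u) := fun u => by
    rw [invFT, invFT]
    congr 1 with ξ
    rw [hh, hm, ← mul_assoc, ← e_add]
    congr 2
    simp only [Prod.fst_add, Prod.snd_add]; ring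
  have := integral_conj_invFT_mul_invFT hg hg2 hi hi2
  simp only [conj_invFT, hinv] at this
  rw [← integral_neg_eq_self]
  simp only [sub_neg_eq_add]
  rw [this, invFT]
  congr 1 with ξ
  rw [hh, hm, Complex.conj_ofReal]
  push_cast; ring

end Plancherel

lemma exists_finset_card_abs_le (d N t : ℝ) (hd : 0 < d) (hN : 0 ≤ N) :
    ∃ A : Finset ℤ, (∀ n : ℤ, n ∈ A ↔ |((n:ℝ) + 1/2) * d + t| ≤ N) ∧
      |(A.card : ℝ) - 2 * N / d| ≤ 1 := by
  refine ⟨Finset.Icc ⌈(-N - t) / d - 1/2⌉ ⌊(N - t) / d - 1/2⌋, fun n => ?_, ?_⟩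
  · rw [Finset.mem_Icc, Int.ceil_le, Int.le_floor, sub_le_iff_le_add, le_sub_iff_add_le,
      div_le_iff₀ hd, le_div_iff₀ hd, abs_le]
    constructor <;> rintro ⟨h1, h2⟩ <;> constructor <;> linarith
  · rw [Int.card_Icc]
    set a := (-N - t) / d - 1/2 with ha
    set b := (N - t) / d - 1/2 with hb
    have hab : b - a = 2 * N / d := by rw [ha, hb]; ring
    have h0 : 0 ≤ 2 * N / d := by positivity
    have h1 := Int.lt_floor_add_one b
    have h2 := Int.ceil_lt_add_one a
    have h3 := Int.floor_le b
    have h4 := Int.le_ceil a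
    have h5 : 0 ≤ ⌊b⌋ + 1 - ⌈a⌉ := by
      have : (-1 : ℝ) < ((⌊b⌋ + 1 - ⌈a⌉ : ℤ) : ℝ) := by push_cast; linarith
      have : (-1 : ℤ) < ⌊b⌋ + 1 - ⌈a⌉ := by exact_mod_cast this
      omega
    have h6 : (((⌊b⌋ + 1 - ⌈a⌉).toNat : ℤ) : ℝ) = ⌊b⌋ + 1 - ⌈a⌉ := by
      rw [Int.toNat_of_nonneg h5]; push_cast; ring
    rw [Int.cast_natCast] at h6
    rw [h6, ← hab, abs_le]
    constructor <;> linarith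

/-- The centers of the tiles of the partition `U_ω`, for tiles of length `L`, height `w` and
slope `σ`. -/
def latticePoint (L w σ : ℝ) (q : ℤ × ℤ) : ℝ × ℝ :=
  (((q.1 : ℝ) + 1/2) * L, σ * (((q.1 : ℝ) + 1/2) * L) + ((q.2 : ℝ) + 1/2) * w)

lemma exists_finset_card_latticePoint (L w σ N : ℝ) (hL : 0 < L) (hw : 0 < w) (hN : 0 ≤ N) (z : ℝ × ℝ) :
    ∃ S : Finset (ℤ × ℤ),
      (∀ q, q ∈ S ↔ latticePoint L w σ q - z ∈ Icc ((-N, -N) : ℝ × ℝ) (N, N)) ∧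
      |(S.card : ℝ) - 4 * N ^ 2 * (L * w)⁻¹| ≤ 2 * N / L + 2 * N / w + 1 := by
  obtain ⟨A, hA, hAc⟩ := exists_finset_card_abs_le L N (-z.1) hL hN
  choose B hB hBc using fun n : ℤ => exists_finset_card_abs_le w N (σ * (((n : ℝ) + 1/2) * L) - z.2) hw hN
  have hsum : |(∑ n ∈ A, ((B n).card : ℝ)) - A.card * (2 * N / w)| ≤ A.card := by
    have : (∑ n ∈ A, ((B n).card : ℝ)) - A.card * (2 * N / w)
        = ∑ n ∈ A, (((B n).card : ℝ) - 2 * N / w) := by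
      rw [Finset.sum_sub_distrib, Finset.sum_const, nsmul_eq_mul]
    rw [this]
    refine (Finset.abs_sum_le_sum_abs _ _).trans ?_
    refine (Finset.sum_le_sum fun n _ => hBc n).trans ?_
    simp
  refine ⟨(A.sigma B).map (Equiv.sigmaEquivProd ℤ ℤ).toEmbedding, fun q => ?_, ?_⟩
  · simp only [Finset.mem_map_equiv, Finset.mem_sigma, hA, hB, latticePoint, mem_Icc, Prod.le_def,
      Prod.fst_sub, Prod.snd_sub, Equiv.sigmaEquivProd_symm_apply, abs_le]
    constructor
    · rintro ⟨⟨h1, h2⟩, h3, h4⟩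
      refine ⟨⟨?_, ?_⟩, ?_, ?_⟩ <;> linarith
    · rintro ⟨⟨h1, h3⟩, h2, h4⟩
      refine ⟨⟨?_, ?_⟩, ?_, ?_⟩ <;> linarith
  · rw [Finset.card_map, Finset.card_sigma]
    push_cast
    have hNw : 0 ≤ 2 * N / w := by positivity
    have e1 : |(A.card : ℝ) * (2 * N / w) - 4 * N ^ 2 * (L * w)⁻¹| ≤ 2 * N / w := by
      have : (A.card : ℝ) * (2 * N / w) - 4 * N ^ 2 * (L * w)⁻¹
          = ((A.card : ℝ) - 2 * N / L) * (2 * N / w) := by field_simp; ring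
      rw [this, abs_mul, abs_of_nonneg hNw]
      nlinarith
    rw [abs_le] at *
    constructor <;> linarith [hsum.1, hsum.2, e1.1, e1.2, hAc.1, hAc.2]
lemma integral_box_tsum {L w : ℝ} (σ : ℝ) {N : ℝ} (hL : 0 < L) (hw : 0 < w) (hN : 0 ≤ N)
    {G : ℝ × ℝ → ℂ} (hG : Integrable G) :
    ‖(∫ p in Icc ((-N, -N) : ℝ × ℝ) (N, N), ∑' q : ℤ × ℤ, G (latticePoint L w σ q - p))
        - ((4 * N ^ 2 * (L * w)⁻¹ : ℝ) : ℂ) * ∫ z, G z‖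
      ≤ (2 * N / L + 2 * N / w + 1) * ∫ z, ‖G z‖ := by
  set Q := Icc ((-N, -N) : ℝ × ℝ) (N, N) with hQ
  have hQm : MeasurableSet Q := measurableSet_Icc
  choose S hS hSc using fun z => exists_finset_card_latticePoint L w σ N hL hw hN z
  set E := 2 * N / L + 2 * N / w + 1 with hE
  set M := 4 * N ^ 2 * (L * w)⁻¹ with hM
  have hE0 : 0 ≤ E := by positivity
  have hM0 : 0 ≤ M := by positivity
  have hSb : ∀ z, ((S z).card : ℝ) ≤ E + M := fun z => by
    have := (abs_le.1 (hSc z)).2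
    linarith
  set T : ℤ × ℤ → Set (ℝ × ℝ) := fun q => (fun z => latticePoint L w σ q - z) ⁻¹' Q with hT
  have hTm : ∀ q, MeasurableSet (T q) := fun q => (measurable_const.sub measurable_id) hQm
  have hmem : ∀ q z, z ∈ T q ↔ q ∈ S z := fun q z => (hS z q).symm
  have hsumE : ∀ z, ∑' q, ‖(T q).indicator G z‖ₑ = (S z).card * ‖G z‖ₑ := fun z => by
    rw [tsum_eq_sum (s := S z)]
    · rw [Finset.sum_congr rfl fun q hq => by
        rw [indicator_of_mem ((hmem q z).2 hq)], Finset.sum_const, nsmul_eq_mul]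
    · intro q hq
      rw [indicator_of_notMem (fun h => hq ((hmem q z).1 h)), enorm_zero]
  have hsum : ∀ z, ∑' q, (T q).indicator G z = (S z).card * G z := fun z => by
    rw [tsum_eq_sum (s := S z)]
    · rw [Finset.sum_congr rfl fun q hq => by
        rw [indicator_of_mem ((hmem q z).2 hq)], Finset.sum_const, nsmul_eq_mul]
    · intro q hq
      rw [indicator_of_notMem (fun h => hq ((hmem q z).1 h))]
  have hfin : ∑' q, ∫⁻ z, ‖(T q).indicator G z‖ₑ ≠ ⊤ := by
    rw [← lintegral_tsum fun q => (hG.aestronglyMeasurable.indicator (hTm q)).enorm]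
    refine ne_top_of_le_ne_top (b := ENNReal.ofReal (E + M) * ∫⁻ z, ‖G z‖ₑ)
      (ENNReal.mul_ne_top ENNReal.ofReal_ne_top hG.2.ne) ?_
    rw [← lintegral_const_mul' _ _ ENNReal.ofReal_ne_top]
    refine lintegral_mono fun z => ?_
    rw [hsumE]
    gcongr
    rw [← ENNReal.ofReal_natCast]
    exact ENNReal.ofReal_le_ofReal (hSb z)
  have hindsub : ∀ q z, Q.indicator (fun p => G (latticePoint L w σ q - p)) (latticePoint L w σ q - z)
      = (T q).indicator G z := fun q z => by
    by_cases h : z ∈ T q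
    · rw [indicator_of_mem h, indicator_of_mem (show latticePoint L w σ q - z ∈ Q from h), sub_sub_cancel]
    · rw [indicator_of_notMem h, indicator_of_notMem (show latticePoint L w σ q - z ∉ Q from h)]
  have hint : ∀ q, ∫ p in Q, G (latticePoint L w σ q - p) = ∫ z, (T q).indicator G z := fun q => by
    rw [← integral_indicator hQm, ← integral_sub_left_eq_self _ _ (latticePoint L w σ q)]
    simp only [hindsub]
  have hlint : ∀ q, ∫⁻ p in Q, ‖G (latticePoint L w σ q - p)‖ₑ
      = ∫⁻ z, ‖(T q).indicator G z‖ₑ := fun q => by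
    rw [← lintegral_indicator hQm, ← lintegral_sub_left_eq_self _ (latticePoint L w σ q)]
    congr 1 with z
    rw [← hindsub, enorm_indicator_eq_indicator_enorm]
  have hmain : ∫ p in Q, ∑' q : ℤ × ℤ, G (latticePoint L w σ q - p) = ∫ z, (S z).card * G z := by
    rw [integral_tsum (fun q => (hG.comp_sub_left _).aestronglyMeasurable.restrict)
      (by simpa only [hlint] using hfin)]
    simp only [hint]
    rw [← integral_tsum (fun q => hG.aestronglyMeasurable.indicator (hTm q)) hfin]
    simp only [hsum]
  have hcm : Measurable fun z => ((S z).card : ℝ) := by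
    have : (fun z => ((S z).card : ℝ))
        = fun z => (∑' q, (T q).indicator (fun _ => (1 : ENNReal)) z).toReal := by
      funext z
      rw [tsum_eq_sum (s := S z)]
      · rw [Finset.sum_congr rfl fun q hq => by
          rw [indicator_of_mem ((hmem q z).2 hq)], Finset.sum_const, nsmul_one,
          ENNReal.toReal_natCast]
      · intro q hq
        rw [indicator_of_notMem (fun h => hq ((hmem q z).1 h))]
    rw [this]
    exact (Measurable.tsum fun q => measurable_const.indicator (hTm q)).ennreal_toReal
  have hci : Integrable fun z => ((S z).card : ℂ) * G z := by
    refine hG.bdd_mul (c := E + M) ?_ (Eventually.of_forall fun z => ?_)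
    · have := (Complex.measurable_ofReal.comp hcm).aestronglyMeasurable (μ := volume)
      simpa [Function.comp_def] using this
    · rw [Complex.norm_natCast]; exact hSb z
  rw [hmain, ← integral_const_mul, ← integral_sub hci (hG.const_mul _), ← integral_const_mul]
  refine norm_integral_le_of_norm_le (hG.norm.const_mul _) (Eventually.of_forall fun z => ?_)
  rw [← sub_mul, norm_mul]
  gcongr
  have := hSc z
  rw [← Complex.ofReal_natCast, ← Complex.ofReal_sub, Complex.norm_real]
  exact this

lemma tendsto_average_box_tsum {L w : ℝ} (σ : ℝ) (hL : 0 < L) (hw : 0 < w)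
    {G : ℝ × ℝ → ℂ} (hG : Integrable G) :
    Tendsto (fun N : ℝ => ((4 * N ^ 2 : ℝ) : ℂ)⁻¹ *
        ∫ p in Icc ((-N, -N) : ℝ × ℝ) (N, N), ∑' q : ℤ × ℤ, G (latticePoint L w σ q - p))
      atTop (nhds (((L * w)⁻¹ : ℝ) * ∫ z, G z)) := by
  rw [tendsto_iff_norm_sub_tendsto_zero]
  have hlim : Tendsto (fun N : ℝ =>
      (1 / (2 * L) * N⁻¹ + 1 / (2 * w) * N⁻¹ + 4⁻¹ * (N⁻¹ * N⁻¹)) * ∫ z, ‖G z‖) atTop (nhds 0) := by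
    have h := tendsto_inv_atTop_zero (𝕜 := ℝ)
    simpa using (((h.const_mul (1 / (2 * L))).add (h.const_mul (1 / (2 * w)))).add
      ((h.mul h).const_mul 4⁻¹)).mul_const (∫ z, ‖G z‖)
  refine squeeze_zero' (Eventually.of_forall fun N => norm_nonneg _) ?_ hlim
  filter_upwards [eventually_gt_atTop 0] with N hN
  have key := integral_box_tsum σ hL hw hN.le hG
  set I := ∫ p in Icc ((-N, -N) : ℝ × ℝ) (N, N), ∑' q : ℤ × ℤ, G (latticePoint L w σ q - p)
  have h4 : (0 : ℝ) < 4 * N ^ 2 := by positivity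
  have h4c : ((4 * N ^ 2 : ℝ) : ℂ) ≠ 0 := Complex.ofReal_ne_zero.2 h4.ne'
  have e1 : ((4 * N ^ 2 : ℝ) : ℂ)⁻¹ * I - ((L * w)⁻¹ : ℝ) * ∫ z, G z
      = ((4 * N ^ 2 : ℝ) : ℂ)⁻¹ * (I - ((4 * N ^ 2 * (L * w)⁻¹ : ℝ) : ℂ) * ∫ z, G z) := by
    rw [mul_sub, Complex.ofReal_mul (4 * N ^ 2), mul_assoc, inv_mul_cancel_left₀ h4c]
  rw [e1, norm_mul, norm_inv, Complex.norm_real, Real.norm_of_nonneg h4.le]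
  refine (mul_le_mul_of_nonneg_left key (by positivity)).trans (le_of_eq ?_)
  field_simp
  ring

lemma integrable_mul_convolution_kernel {φ f : ℝ × ℝ → ℂ} (hφ : Continuous φ) (hφ2 : MemLp φ 2)
    (hf : Integrable f) (x : ℝ × ℝ) :
    Integrable (fun P : (ℝ × ℝ) × (ℝ × ℝ) => f P.1 * (φ (P.2 - P.1) * φ (x - P.2)))
      (volume.prod volume) := by
  have hsq : Integrable fun u => ‖φ u‖ ^ 2 := (memLp_two_iff_integrable_sq_norm
    hφ.aestronglyMeasurable).1 hφ2
  have hsq1 : ∀ y, Integrable fun z => ‖φ (z - y)‖ ^ 2 := fun y => hsq.comp_sub_right y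
  have hsq2 : Integrable fun z => ‖φ (x - z)‖ ^ 2 := hsq.comp_sub_left x
  have hle : ∀ y z, ‖φ (z - y) * φ (x - z)‖ ≤ ‖φ (z - y)‖ ^ 2 + ‖φ (x - z)‖ ^ 2 := fun y z => by
    rw [norm_mul]
    nlinarith [sq_nonneg (‖φ (z - y)‖ - ‖φ (x - z)‖), sq_nonneg ‖φ (z - y)‖,
      sq_nonneg ‖φ (x - z)‖]
  have hker : ∀ y, Integrable fun z => φ (z - y) * φ (x - z) := fun y =>
    ((hsq1 y).add hsq2).mono' (by fun_prop) (Eventually.of_forall (hle y))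
  have hmeas : AEStronglyMeasurable
      (fun P : (ℝ × ℝ) × (ℝ × ℝ) => f P.1 * (φ (P.2 - P.1) * φ (x - P.2)))
      (volume.prod volume) :=
    hf.aestronglyMeasurable.comp_fst.mul (Continuous.aestronglyMeasurable (by fun_prop))
  refine (integrable_prod_iff hmeas).2
    ⟨Eventually.of_forall fun y => (hker y).const_mul (f y), ?_⟩
  refine (hf.norm.mul_const (2 * ∫ u, ‖φ u‖ ^ 2)).mono' hmeas.norm.integral_prod_right'
    (Eventually.of_forall fun y => ?_)
  rw [Real.norm_of_nonneg (integral_nonneg fun z => norm_nonneg _)]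
  simp only [norm_mul (f y), integral_const_mul]
  gcongr
  calc ∫ z, ‖φ (z - y) * φ (x - z)‖
      ≤ ∫ z, (‖φ (z - y)‖ ^ 2 + ‖φ (x - z)‖ ^ 2) :=
        integral_mono (hker y).norm ((hsq1 y).add hsq2) (hle y)
    _ = 2 * ∫ u, ‖φ u‖ ^ 2 := by
        rw [integral_add (hsq1 y) hsq2, integral_sub_right_eq_self (fun u => ‖φ u‖ ^ 2),
          integral_sub_left_eq_self (fun u => ‖φ u‖ ^ 2), two_mul]

lemma mhat_mem_Icc {β βt : ℝ → ℝ} (hβ : IsBumpβ β) (hβt : IsBumpβt βt) (cc : ℕ) (w : ℝ)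
    (s : Tile) (ξ : ℝ × ℝ) : mhat β βt cc w s ξ ∈ Icc (0 : ℝ) 1 :=
  ⟨mul_nonneg (hβt.2.1 _).1 (hβ.2.1 _).1,
    mul_le_one₀ (hβt.2.1 _).2 (hβ.2.1 _).1 (hβ.2.1 _).2⟩

lemma measurable_mhat {β βt : ℝ → ℝ} (hβ : IsBumpβ β) (hβt : IsBumpβt βt) (cc : ℕ) (w : ℝ)
    (s : Tile) : Measurable (mhat β βt cc w s) := by
  have h1 := hβ.1.continuous.measurable
  have h2 := hβt.1.continuous.measurable
  unfold mhat
  fun_prop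

lemma exists_mhat_eq_zero {β βt : ℝ → ℝ} (hβ : IsBumpβ β) (hβt : IsBumpβt βt) (cc : ℕ) {w : ℝ}
    (hw : 0 < w) (s : Tile) :
    ∃ R : ℝ, ∀ ξ, ξ ∉ Icc ((-R, -R) : ℝ × ℝ) (R, R) → mhat β βt cc w s ξ = 0 := by
  set a := ((s.m : ℝ) + 3/4) * s.freqLen with ha
  refine ⟨(2 + |a|) * (5 / (2 * w)), fun ξ hξ => ?_⟩
  by_contra hne
  refine hξ ?_
  have h1 : w * ξ.2 ∈ Icc (1/2 : ℝ) (5/2) := by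
    by_contra h
    exact hne (by rw [mhat, hβt.2.2.2 _ h, zero_mul])
  have h2 : |(2:ℝ) ^ (s.l + cc) * (ξ.1 / ξ.2 - a)| < 2 := by
    by_contra! h
    exact hne (by rw [mhat, hβ.2.2.2.1 _ h, mul_zero])
  have hη : 0 < ξ.2 := by
    by_contra! h
    nlinarith [h1.1]
  have hη2 : ξ.2 ≤ 5 / (2 * w) := by
    rw [le_div_iff₀ (by positivity)]
    linarith [h1.2]
  have hr : |ξ.1 / ξ.2 - a| ≤ 2 := by
    rw [abs_mul, abs_of_pos (by positivity)] at h2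
    have : (1 : ℝ) ≤ 2 ^ (s.l + cc) := one_le_pow₀ (by norm_num)
    nlinarith [abs_nonneg (ξ.1 / ξ.2 - a)]
  have hr2 : |ξ.1 / ξ.2| ≤ 2 + |a| := by
    have := abs_add_le (ξ.1 / ξ.2 - a) a
    rw [sub_add_cancel] at this
    linarith
  have hx : |ξ.1| ≤ (2 + |a|) * (5 / (2 * w)) := by
    rw [abs_div, abs_of_pos hη, div_le_iff₀ hη] at hr2
    exact hr2.trans (by gcongr)
  have hy : |ξ.2| ≤ (2 + |a|) * (5 / (2 * w)) := by
    rw [abs_of_pos hη]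
    nlinarith [abs_nonneg a]
  exact ⟨⟨(abs_le.1 hx).1, (abs_le.1 hy).1⟩, (abs_le.1 hx).2, (abs_le.1 hy).2⟩

lemma memLp_sqrt_mhat {β βt : ℝ → ℝ} (hβ : IsBumpβ β) (hβt : IsBumpβt βt) (cc : ℕ) {w : ℝ}
    (hw : 0 < w) (s : Tile) (p : ENNReal) :
    MemLp (fun ξ => ((Real.sqrt (mhat β βt cc w s ξ) : ℝ) : ℂ)) p := by
  obtain ⟨R, hR⟩ := exists_mhat_eq_zero hβ hβt cc hw s
  have hK : MemLp ((Icc ((-R, -R) : ℝ × ℝ) (R, R)).indicator fun _ => (1 : ℝ)) p :=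
    memLp_indicator_const p measurableSet_Icc 1 (Or.inr isCompact_Icc.measure_lt_top.ne)
  refine hK.mono (Complex.measurable_ofReal.comp
    (measurable_mhat hβ hβt cc w s).sqrt).aestronglyMeasurable (Eventually.of_forall fun ξ => ?_)
  by_cases h : ξ ∈ Icc ((-R, -R) : ℝ × ℝ) (R, R)
  · rw [indicator_of_mem h, Complex.norm_real, Real.norm_of_nonneg (Real.sqrt_nonneg _), norm_one]
    exact Real.sqrt_le_one.2 (mhat_mem_Icc hβ hβt cc w s ξ).2
  · rw [hR ξ h, Real.sqrt_zero, Complex.ofReal_zero, norm_zero]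
    exact norm_nonneg _

/-- the Fourier summation lemma, `f * m_ω(x) = lim_{N→∞} (1/(4N²))·
∫_{[−N,N]²} Σ_{s∈U_ω} ⟨f, φ_s(p + ·)⟩·φ_s(p + x) dp`.  The tiles of `U_ω` are
parameterized by their spatial positions `q = (n,k) ∈ ℤ × ℤ`. -/
theorem fourier_summation
    (β βt : ℝ → ℝ) (hβ : IsBumpβ β) (hβt : IsBumpβt βt) (cc : ℕ)
    (w : ℝ) (hw : 0 < w) (f : SchwartzMap (ℝ × ℝ) ℂ) (s₀ : Tile) (x : ℝ × ℝ) :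
    Tendsto (fun N : ℝ =>
        (((4 * N ^ 2 : ℝ)) : ℂ)⁻¹ *
          ∫ p in Icc ((-N, -N) : ℝ × ℝ) ((N, N) : ℝ × ℝ),
            ∑' q : ℤ × ℤ,
              (∫ y : ℝ × ℝ, f y *
                  (starRingEnd ℂ)
                    (wp β βt cc w ⟨s₀.l, s₀.m, q.1, q.2, s₀.hlo, s₀.hhi⟩ (p + y))) *
                wp β βt cc w ⟨s₀.l, s₀.m, q.1, q.2, s₀.hlo, s₀.hhi⟩ (p + x))
      atTop
      (nhds (∫ y : ℝ × ℝ, f y * mInv β βt cc w s₀ (x - y))) := by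
  have hg := memLp_one_iff_integrable.1 (memLp_sqrt_mhat hβ hβt cc hw s₀ 1)
  have hg2 := memLp_sqrt_mhat hβ hβt cc hw s₀ 2
  set φ := φω β βt cc w s₀ with hφ
  have hφinv : φ = invFT fun ξ => ((Real.sqrt (mhat β βt cc w s₀ ξ) : ℝ) : ℂ) := rfl
  have hφc : Continuous φ := continuous_invFT hg
  have hφ2 : MemLp φ 2 := memLp_invFT hg hg2
  have hφconj : ∀ u, starRingEnd ℂ (φ u) = φ (-u) := conj_invFT _
  have hφm : ∀ v, ∫ u, φ u * φ (v - u) = mInv β βt cc w s₀ v := fun v => by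
    rw [hφinv, integral_invFT_mul_invFT_sub hg hg2]
    simp only [Real.sq_sqrt (mhat_mem_Icc hβ hβt cc w s₀ _).1]
    rfl
  have hker := integrable_mul_convolution_kernel hφc hφ2 f.integrable x
  set G : ℝ × ℝ → ℂ := fun z => ∫ y, f y * (φ (z - y) * φ (x - z)) with hGdef
  have hG : Integrable G := hker.integral_prod_right
  have hGint : ∫ z, G z = ∫ y, f y * mInv β βt cc w s₀ (x - y) := by
    rw [hGdef, ← integral_integral_swap hker]
    congr 1 with y
    rw [integral_const_mul, ← hφm,
      ← integral_sub_right_eq_self (fun u => φ u * φ (x - y - u)) y]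
    simp only [sub_sub_sub_cancel_right]
  set A := s₀.area w with hA
  have hA0 : 0 < A := mul_pos (pow_pos hw 2) (by positivity)
  have hlen : 0 < s₀.len w := mul_pos hw (by positivity)
  have hLw : s₀.len w * w = A := by
    rw [hA, Tile.len, Tile.area]; ring
  have hsum : ∀ (p : ℝ × ℝ) (q : ℤ × ℤ),
      (∫ y : ℝ × ℝ, f y * (starRingEnd ℂ)
          (wp β βt cc w ⟨s₀.l, s₀.m, q.1, q.2, s₀.hlo, s₀.hhi⟩ (p + y))) *
        wp β βt cc w ⟨s₀.l, s₀.m, q.1, q.2, s₀.hlo, s₀.hhi⟩ (p + x)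
      = (A : ℂ) * G (latticePoint (s₀.len w) w s₀.slope q - p) := fun p q => by
    set c := latticePoint (s₀.len w) w s₀.slope q with hc
    have hwp : ∀ v, wp β βt cc w ⟨s₀.l, s₀.m, q.1, q.2, s₀.hlo, s₀.hhi⟩ v
        = ((Real.sqrt A : ℝ) : ℂ) * φ (v - c) := fun v => rfl
    have hAs : ((Real.sqrt A : ℝ) : ℂ) * ((Real.sqrt A : ℝ) : ℂ) = A := by
      rw [← Complex.ofReal_mul, Real.mul_self_sqrt hA0.le]
    simp only [hwp, hGdef]
    rw [← integral_mul_const, ← integral_const_mul]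
    congr 1 with y
    rw [map_mul, Complex.conj_ofReal, hφconj, ← hAs, show -(p + y - c) = c - p - y by abel,
      show x - (c - p) = p + x - c by abel]
    ring
  simp only [hsum, tsum_mul_left, integral_const_mul]
  have key := (tendsto_average_box_tsum s₀.slope hlen hw hG).const_mul (A : ℂ)
  rw [hLw, hGint, ← mul_assoc, ← Complex.ofReal_mul, mul_inv_cancel₀ hA0.ne', Complex.ofReal_one,
    one_mul] at key
  refine key.congr fun N => ?_
  ring
end Bateman
end
end

section
/- [Density lemma] There is an absolute constant C such that the following holds for every w > 0, every measurable u : ℝ → ℝ with |u| ≤ 1, every measurable E ⊆ ℝ², and every δ > 0. If ℛ ⊆ U is a collection of tiles that are pairwise incomparable under ≤ and such that dense(R) ≥ δ for every R ∈ ℛ, then Σ_{R∈ℛ} |R| ≤ C·|E|/δ. -/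
open MeasureTheory Set Filter
open scoped Classical

noncomputable section

namespace Bateman

/-- The parallelogram with sides of slope `s`, `x`-projection `I` and vertical section `J`. -/
def shearBox (s : ℝ) (I J : Set ℝ) : Set (ℝ × ℝ) := {p | p.1 ∈ I ∧ p.2 - s * p.1 ∈ J}

theorem measurableSet_shearBox (s : ℝ) {I J : Set ℝ} (hI : MeasurableSet I)
    (hJ : MeasurableSet J) : MeasurableSet (shearBox s I J) :=
  (measurable_fst hI).inter
    ((measurable_snd.sub (measurable_const.mul measurable_fst)) hJ)

theorem volume_shearBox (s : ℝ) {I J : Set ℝ} (hI : MeasurableSet I) (hJ : MeasurableSet J) :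
    volume (shearBox s I J) = volume I * volume J := by
  rw [Measure.volume_eq_prod, Measure.prod_apply (measurableSet_shearBox s hI hJ)]
  have h : ∀ x : ℝ, volume (Prod.mk x ⁻¹' shearBox s I J) = I.indicator (fun _ => volume J) x := by
    intro x
    by_cases hx : x ∈ I
    · rw [indicator_of_mem hx]
      have : Prod.mk x ⁻¹' shearBox s I J = (fun y => y + -(s * x)) ⁻¹' J := by
        ext y
        simp [shearBox, hx, sub_eq_add_neg]
      rw [this, measure_preimage_add_right]
    · rw [indicator_of_notMem hx]
      have : Prod.mk x ⁻¹' shearBox s I J = ∅ := by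
        ext y
        simp [shearBox, hx]
      rw [this, measure_empty]
  simp_rw [h]
  rw [lintegral_indicator_const hI, mul_comm]

/-- A greedy covering bound: if every nonempty subfamily has a member `r` whose relatives have
total weight at most `K` times the weight of `r`, and unrelated members have disjoint sets `G`,
then the total weight is controlled by the measure of `E`. -/
theorem sum_weight_le_of_greedy {ι α : Type*} [MeasurableSpace α] (μ : Measure α)
    (rel : ι → ι → Prop) (a : ι → ENNReal) (G : ι → Set α) (K β : ENNReal)
    (hG : ∀ i, MeasurableSet (G i)) (hrefl : ∀ i, rel i i)
    (hdisj : ∀ i j, ¬ rel i j → Disjoint (G i) (G j)) (S : Finset ι)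
    (hS : ∀ T ⊆ S, T.Nonempty → ∃ r ∈ T, ∑ i ∈ T with rel i r, a i ≤ K * a r)
    (E : Set α) (hE : ∀ i ∈ S, β * a i ≤ μ (E ∩ G i)) :
    β * ∑ i ∈ S, a i ≤ K * μ E := by
  induction S using Finset.strongInduction generalizing E with
  | H S ih =>
    rcases S.eq_empty_or_nonempty with rfl | hne
    · simp
    obtain ⟨r, hr, hsum⟩ := hS S subset_rfl hne
    have hlt : {i ∈ S | ¬ rel i r} ⊂ S :=
      Finset.filter_ssubset.2 ⟨r, hr, not_not.2 (hrefl r)⟩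
    have hrest := ih _ hlt (fun T hT => hS T (hT.trans hlt.subset)) (E \ G r) (by
      intro i hi
      rw [Finset.mem_filter] at hi
      have : E \ G r ∩ G i = E ∩ G i := by
        ext x
        simp only [mem_inter_iff, Set.mem_sdiff]
        exact ⟨fun h => ⟨h.1.1, h.2⟩, fun h => ⟨⟨h.1, fun hx =>
          (Set.disjoint_left.1 (hdisj i r hi.2)) h.2 hx⟩, h.2⟩⟩
      rw [this]
      exact hE i hi.1)
    rw [← Finset.sum_filter_add_sum_filter_not S (fun i => rel i r), mul_add,
      ← measure_inter_add_sdiff E (hG r), mul_add]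
    refine add_le_add ?_ hrest
    calc β * ∑ i ∈ S with rel i r, a i ≤ β * (K * a r) := by gcongr
      _ = K * (β * a r) := by ring
      _ ≤ K * μ (E ∩ G r) := by gcongr; exact hE r hr

namespace Tile

variable {w : ℝ}

theorem freqLen_pos (s : Tile) : 0 < s.freqLen := by unfold freqLen; positivity

theorem len_pos (hw : 0 < w) (s : Tile) : 0 < s.len w := by unfold len; positivity

theorem area_pos (hw : 0 < w) (s : Tile) : 0 < s.area w := by unfold area; positivity

theorem area_eq (s : Tile) : s.area w = s.len w * w := by unfold area len; ring

theorem freqLen_mul_len (s : Tile) : s.freqLen * s.len w = w := by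
  unfold freqLen len
  rw [zpow_neg, zpow_natCast]
  field_simp

theorem len_le_len (hw : 0 < w) {s s' : Tile} (h : s.l ≤ s'.l) : s.len w ≤ s'.len w := by
  unfold len
  gcongr
  norm_num

theorem freqLen_eq_pow_mul {s s' : Tile} (h : s.l ≤ s'.l) :
    s.freqLen = 2 ^ (s'.l - s.l) * s'.freqLen := by
  unfold freqLen
  rw [← zpow_natCast, ← zpow_add₀ two_ne_zero]
  congr 1
  omega

theorem slope_mem_ω (s : Tile) : s.slope ∈ s.ω := by
  have := s.freqLen_pos
  constructor <;> unfold slope <;> nlinarith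

theorem measurableSet_ω (s : Tile) : MeasurableSet s.ω := measurableSet_Ico

/-- Dyadic nesting: of two meeting frequency intervals, the one of larger scale index is
contained in the other. -/
theorem ω_subset_ω {s s' : Tile} (h : s.l ≤ s'.l) (hne : (s.ω ∩ s'.ω).Nonempty) :
    s'.ω ⊆ s.ω := by
  obtain ⟨t, ⟨h1, h2⟩, h3, h4⟩ := hne
  have hf := s'.freqLen_pos
  have he := freqLen_eq_pow_mul h
  have hlo : s.m * 2 ^ (s'.l - s.l) ≤ s'.m := by
    rw [← Int.lt_add_one_iff]
    have : (s.m : ℝ) * 2 ^ (s'.l - s.l) < s'.m + 1 := by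
      refine lt_of_mul_lt_mul_right ?_ hf.le
      rw [mul_assoc, ← he]
      exact h1.trans_lt h4
    exact_mod_cast this
  have hhi : s'.m + 1 ≤ (s.m + 1) * 2 ^ (s'.l - s.l) := by
    rw [Int.add_one_le_iff]
    have : (s'.m : ℝ) < (s.m + 1) * 2 ^ (s'.l - s.l) := by
      refine lt_of_mul_lt_mul_right ?_ hf.le
      rw [mul_assoc, ← he]
      exact h3.trans_lt h2
    exact_mod_cast this
  have hlo' : (s.m : ℝ) * 2 ^ (s'.l - s.l) ≤ s'.m := by exact_mod_cast hlo
  have hhi' : (s'.m : ℝ) + 1 ≤ (s.m + 1) * 2 ^ (s'.l - s.l) := by exact_mod_cast hhi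
  refine Ico_subset_Ico ?_ ?_
  · rw [he, ← mul_assoc]
    gcongr
  · rw [he, ← mul_assoc]
    gcongr

theorem abs_slope_sub_le {s : Tile} {t : ℝ} (h : t ∈ s.ω) : |s.slope - t| ≤ s.freqLen := by
  obtain ⟨h1, h2⟩ := h
  have := s.freqLen_pos
  rw [abs_le]
  unfold slope
  constructor <;> nlinarith

/-- The closed dilate of a tile by the factor `2N`. -/
def box (w N : ℝ) (s : Tile) : Set (ℝ × ℝ) :=
  {p | |p.1 - ((s.n : ℝ) + 1/2) * s.len w| ≤ N * s.len w ∧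
    |p.2 - s.slope * p.1 - ((s.k : ℝ) + 1/2) * w| ≤ N * w}

theorem rect_eq_shearBox (s : Tile) : s.rect w = shearBox s.slope
    (Ico ((s.n : ℝ) * s.len w) (((s.n : ℝ) + 1) * s.len w))
    (Ico ((s.k : ℝ) * w) (((s.k : ℝ) + 1) * w)) := rfl

theorem measurableSet_rect (s : Tile) : MeasurableSet (s.rect w) :=
  measurableSet_shearBox _ measurableSet_Ico measurableSet_Ico

theorem volume_rect (hw : 0 < w) (s : Tile) :
    volume (s.rect w) = ENNReal.ofReal (s.area w) := by
  have := s.len_pos hw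
  rw [rect_eq_shearBox, volume_shearBox _ measurableSet_Ico measurableSet_Ico, Real.volume_Ico,
    Real.volume_Ico, ← ENNReal.ofReal_mul (by linarith), area_eq]
  congr 1
  ring

theorem box_eq_shearBox (N : ℝ) (s : Tile) : s.box w N = shearBox s.slope
    (Metric.closedBall (((s.n : ℝ) + 1/2) * s.len w) (N * s.len w))
    (Metric.closedBall (((s.k : ℝ) + 1/2) * w) (N * w)) := by
  ext p
  simp only [box, shearBox, Metric.mem_closedBall, Real.dist_eq, mem_ofPred_eq]

theorem measurableSet_box (N : ℝ) (s : Tile) : MeasurableSet (s.box w N) := by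
  rw [box_eq_shearBox]
  exact measurableSet_shearBox _ measurableSet_closedBall measurableSet_closedBall

theorem volume_box (hw : 0 < w) {N : ℝ} (hN : 0 ≤ N) (s : Tile) :
    volume (s.box w N) = ENNReal.ofReal (4 * N ^ 2) * ENNReal.ofReal (s.area w) := by
  have := s.len_pos hw
  rw [box_eq_shearBox, volume_shearBox _ measurableSet_closedBall measurableSet_closedBall,
    Real.volume_closedBall, Real.volume_closedBall, ← ENNReal.ofReal_mul (by positivity),
    ← ENNReal.ofReal_mul (by positivity), area_eq]
  congr 1
  ring

theorem center_mem_box (hw : 0 < w) {N : ℝ} (hN : 0 ≤ N) (s : Tile) :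
    s.center w ∈ s.box w N := by
  have := s.len_pos hw
  constructor
  · simp only [center, sub_self, abs_zero]
    positivity
  · have h : (s.center w).2 - s.slope * (s.center w).1 - ((s.k : ℝ) + 1/2) * w = 0 := by
      simp only [center]
      ring
    rw [h, abs_zero]
    positivity

theorem rect_subset_box (s : Tile) : s.rect w ⊆ s.box w (1/2) := by
  rintro p ⟨⟨h1, h2⟩, h3, h4⟩
  constructor <;> rw [abs_le] <;> constructor <;> linarith

theorem box_subset_dilate {N : ℝ} (hw : 0 < w) (hN : N < 5) (s : Tile) :
    s.box w N ⊆ s.dilate w 10 := by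
  rintro p ⟨h1, h2⟩
  have hl := s.len_pos hw
  have hNl : N * s.len w < 5 * s.len w := by gcongr
  have hNw : N * w < 5 * w := by gcongr
  rw [abs_le] at h1 h2
  refine ⟨s.center w + (1/10 : ℝ) • (p - s.center w), ⟨?_, ?_⟩, ?_⟩
  · simp only [center, Prod.fst_add, Prod.smul_fst, Prod.fst_sub, smul_eq_mul]
    constructor <;> linarith
  · simp only [center, Prod.fst_add, Prod.smul_fst, Prod.fst_sub, smul_eq_mul, Prod.snd_add,
      Prod.smul_snd, Prod.snd_sub]
    constructor <;> linarith
  · simp [smul_smul]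

/-- If dilates of `s` and `s'` meet and `s` is the shorter of two tiles with meeting frequency
intervals, then any dilate of `s` lies in a comparable dilate of `s'`. -/
theorem box_subset_box (hw : 0 < w) {N M M' : ℝ} {s s' : Tile} (h : s.l ≤ s'.l)
    (hω : (s.ω ∩ s'.ω).Nonempty) (hne : (s.box w M ∩ s'.box w M').Nonempty) (hN : 0 ≤ N) :
    s.box w N ⊆ s'.box w (2 * (N + M) + M') := by
  rintro z ⟨hz1, hz2⟩
  obtain ⟨p, ⟨hp1, hp2⟩, hq1, hq2⟩ := hne
  have hl := s.len_pos hw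
  have hl' := s'.len_pos hw
  have hM : 0 ≤ M := by
    have := (abs_nonneg _).trans hp1
    exact nonneg_of_mul_nonneg_left this hl
  have hll := len_le_len hw h
  have hdx : |z.1 - p.1| ≤ (N + M) * s.len w := by
    have := abs_sub_le z.1 (((s.n : ℝ) + 1/2) * s.len w) p.1
    rw [abs_sub_comm (((s.n : ℝ) + 1/2) * s.len w) p.1] at this
    linarith
  have hdx' : (N + M) * s.len w ≤ (N + M) * s'.len w := by gcongr
  have hslope : |(s.slope - s'.slope) * (z.1 - p.1)| ≤ (N + M) * w := by
    rw [abs_mul]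
    calc |s.slope - s'.slope| * |z.1 - p.1| ≤ s.freqLen * ((N + M) * s.len w) := by
          gcongr
          · exact s.freqLen_pos.le
          · exact abs_slope_sub_le (ω_subset_ω h hω s'.slope_mem_ω)
      _ = (N + M) * (s.freqLen * s.len w) := by ring
      _ = (N + M) * w := by rw [freqLen_mul_len]
  rw [abs_le] at *
  have h0 : 0 ≤ (N + M) * s'.len w := by positivity
  constructor <;> rw [abs_le] <;> constructor <;> linarith

theorem disjoint_rect_of_not_le (hw : 0 < w) {s s' : Tile} (h : s.l ≤ s'.l)
    (hω : (s.ω ∩ s'.ω).Nonempty) (hle : ¬ Tile.le w s s') :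
    Disjoint (s.rect w) (s'.rect w) := by
  rw [Set.disjoint_iff_inter_eq_empty, ← Set.not_nonempty_iff_eq_empty]
  intro hne
  refine hle ⟨?_, ω_subset_ω h hω⟩
  have hbox := box_subset_box hw h hω
    (hne.mono (inter_subset_inter s.rect_subset_box s'.rect_subset_box)) one_half_pos.le
  exact s.rect_subset_box.trans (hbox.trans (s'.box_subset_dilate hw (by norm_num)))

/-- Two tiles are `N`-related when their `N`-boxes and their frequency intervals both meet. -/
def Related (w N : ℝ) (s s' : Tile) : Prop :=
  (s.box w N ∩ s'.box w N).Nonempty ∧ (s.ω ∩ s'.ω).Nonempty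

/-- Pairwise incomparable tiles that are shorter than `s'` and related to it have total area
controlled by that of `s'`. -/
theorem sum_area_related_le (hw : 0 < w) {N : ℝ} (hN : 1 ≤ N) (s' : Tile) (T : Finset Tile)
    (hinc : ∀ R ∈ T, ∀ R' ∈ T, R ≠ R' → ¬ Tile.le w R R' ∧ ¬ Tile.le w R' R)
    (hl : ∀ R ∈ T, R.l ≤ s'.l) (hrel : ∀ R ∈ T, Related w N R s') :
    ∑ R ∈ T, ENNReal.ofReal (R.area w) ≤
      ENNReal.ofReal (100 * N ^ 2) * ENNReal.ofReal (s'.area w) := by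
  have hmeet : ∀ R ∈ T, s'.slope ∈ R.ω := fun R hR =>
    ω_subset_ω (hl R hR) (hrel R hR).2 s'.slope_mem_ω
  have hd : Set.PairwiseDisjoint (T : Set Tile) (fun R => R.rect w) := by
    intro R hR R' hR' hne
    have hi := hinc R hR R' hR' hne
    rcases le_total R.l R'.l with h | h
    · exact disjoint_rect_of_not_le hw h ⟨_, hmeet R hR, hmeet R' hR'⟩ hi.1
    · exact (disjoint_rect_of_not_le hw h ⟨_, hmeet R' hR', hmeet R hR⟩ hi.2).symm
  have hsub : ⋃ R ∈ T, R.rect w ⊆ s'.box w (5 * N) := by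
    refine iUnion₂_subset fun R hR => R.rect_subset_box.trans ?_
    refine (box_subset_box hw (hl R hR) (hrel R hR).2 (hrel R hR).1 (by norm_num)).trans ?_
    have := s'.len_pos hw
    rintro p ⟨h1, h2⟩
    have hc : 2 * (1/2 + N) + N ≤ 5 * N := by linarith
    exact ⟨h1.trans (by gcongr), h2.trans (by gcongr)⟩
  calc ∑ R ∈ T, ENNReal.ofReal (R.area w) = volume (⋃ R ∈ T, R.rect w) := by
        rw [measure_biUnion_finset hd fun R _ => R.measurableSet_rect]
        simp_rw [volume_rect hw]
    _ ≤ volume (s'.box w (5 * N)) := measure_mono hsub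
    _ = _ := by
        rw [volume_box hw (by linarith)]
        congr 2
        ring

/-- The part of the `N`-box of `s` where the direction field points into `ω_s`. -/
def dirBox (w : ℝ) (u : ℝ → ℝ) (N : ℝ) (s : Tile) : Set (ℝ × ℝ) :=
  {p | u p.1 ∈ s.ω} ∩ s.box w N

theorem measurableSet_dirBox {u : ℝ → ℝ} (hu : Measurable u) (N : ℝ) (s : Tile) :
    MeasurableSet (s.dirBox w u N) :=
  ((hu.comp measurable_fst) s.measurableSet_ω).inter (s.measurableSet_box N)

theorem mul_sum_area_le (hw : 0 < w) {N : ℝ} (hN : 1 ≤ N) {u : ℝ → ℝ} (hu : Measurable u)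
    (E : Set (ℝ × ℝ)) (β : ENNReal) (S : Finset Tile)
    (hinc : ∀ R ∈ S, ∀ R' ∈ S, R ≠ R' → ¬ Tile.le w R R' ∧ ¬ Tile.le w R' R)
    (hS : ∀ R ∈ S, β * ENNReal.ofReal (R.area w) ≤ volume (E ∩ R.dirBox w u N)) :
    β * ∑ R ∈ S, ENNReal.ofReal (R.area w) ≤ ENNReal.ofReal (100 * N ^ 2) * volume E := by
  refine sum_weight_le_of_greedy volume (Related w N) _ (fun R => R.dirBox w u N) _ β
    (measurableSet_dirBox hu N) ?_ ?_ S ?_ E hS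
  · exact fun R => ⟨⟨R.center w, R.center_mem_box hw (by linarith), R.center_mem_box hw
      (by linarith)⟩, ⟨R.slope, R.slope_mem_ω, R.slope_mem_ω⟩⟩
  · intro R R' h
    rw [Set.disjoint_left]
    exact fun p hp hp' => h ⟨⟨p, hp.2, hp'.2⟩, ⟨u p.1, hp.1, hp'.1⟩⟩
  · intro T hT hne
    obtain ⟨r, hr, hmax⟩ := T.exists_max_image Tile.l hne
    refine ⟨r, hr, sum_area_related_le hw hN r _ ?_ ?_ ?_⟩
    · intro R hR R' hR'
      exact hinc R (hT (Finset.mem_filter.1 hR).1) R' (hT (Finset.mem_filter.1 hR').1)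
    · exact fun R hR => hmax R (Finset.mem_filter.1 hR).1
    · exact fun R hR => (Finset.mem_filter.1 hR).2

end Tile

theorem chi_nonneg (p : ℝ × ℝ) : 0 ≤ chi p := by
  unfold chi
  positivity

theorem chi_le_one (p : ℝ × ℝ) : chi p ≤ 1 := by
  unfold chi
  refine inv_le_one_of_one_le₀ ?_
  have : 0 ≤ (p.1 ^ 2 + p.2 ^ 2) ^ 50 := by positivity
  linarith

theorem chi_le_of_le_abs {p : ℝ × ℝ} {t : ℝ} (ht : 1 ≤ t) (h : t ≤ |p.1| ∨ t ≤ |p.2|) :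
    chi p ≤ (t ^ 4)⁻¹ := by
  have h2 : t ^ 2 ≤ p.1 ^ 2 + p.2 ^ 2 := by
    rcases h with h | h
    · have : t ^ 2 ≤ |p.1| ^ 2 := by gcongr
      rw [sq_abs] at this
      nlinarith [sq_nonneg p.2]
    · have : t ^ 2 ≤ |p.2| ^ 2 := by gcongr
      rw [sq_abs] at this
      nlinarith [sq_nonneg p.1]
  unfold chi
  refine inv_anti₀ (by positivity) ?_
  calc t ^ 4 ≤ t ^ 100 := pow_le_pow_right₀ ht (by norm_num)
    _ = (t ^ 2) ^ 50 := by ring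
    _ ≤ (p.1 ^ 2 + p.2 ^ 2) ^ 50 := by gcongr
    _ ≤ _ := by linarith

/-- The weight `χ` is dominated on dyadic boxes with polynomial decay. -/
theorem exists_chi_le (p : ℝ × ℝ) :
    ∃ j : ℕ, |p.1| ≤ 2 ^ j ∧ |p.2| ≤ 2 ^ j ∧ chi p ≤ 16 * (1/16) ^ j := by
  have hex : ∃ j : ℕ, |p.1| ≤ 2 ^ j ∧ |p.2| ≤ 2 ^ j := by
    obtain ⟨j, hj⟩ := pow_unbounded_of_one_lt (max |p.1| |p.2|) (one_lt_two (α := ℝ))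
    exact ⟨j, (le_max_left _ _).trans hj.le, (le_max_right _ _).trans hj.le⟩
  refine ⟨Nat.find hex, (Nat.find_spec hex).1, (Nat.find_spec hex).2, ?_⟩
  rcases h : Nat.find hex with _ | i
  · have := chi_le_one p
    norm_num
    linarith
  · have hmin := Nat.find_min hex (m := i) (by omega)
    rw [not_and_or, not_le, not_le] at hmin
    refine (chi_le_of_le_abs (t := 2 ^ i) (one_le_pow₀ one_le_two)
      (hmin.imp le_of_lt le_of_lt)).trans (le_of_eq ?_)
    rw [← pow_mul, mul_comm, pow_mul, ← inv_pow, pow_succ]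
    norm_num
    ring

theorem exists_mem_box_chi1_le {w : ℝ} (hw : 0 < w) (s : Tile) (p : ℝ × ℝ) :
    ∃ j : ℕ, p ∈ s.box w (2 ^ j) ∧ chi1 w s p ≤ (s.area w)⁻¹ * (16 * (1/16) ^ j) := by
  obtain ⟨j, h1, h2, h3⟩ := exists_chi_le (s.unitMap w p)
  have hl := s.len_pos hw
  have ha := s.area_pos hw
  refine ⟨j, ⟨?_, ?_⟩, ?_⟩
  · rwa [Tile.unitMap, abs_div, abs_of_pos hl, div_le_iff₀ hl] at h1
  · rwa [Tile.unitMap, abs_div, abs_of_pos hw, div_le_iff₀ hw] at h2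
  · unfold chi1
    gcongr

theorem lintegral_chi1_le {w : ℝ} (hw : 0 < w) (u : ℝ → ℝ) (E : Set (ℝ × ℝ)) (s : Tile) :
    ∫⁻ p in {p ∈ E | u p.1 ∈ s.ω}, ENNReal.ofReal (chi1 w s p) ≤
      ∑' j : ℕ, ENNReal.ofReal ((s.area w)⁻¹ * (16 * (1/16) ^ j)) *
        volume (E ∩ s.dirBox w u (2 ^ j)) := by
  calc ∫⁻ p in {p ∈ E | u p.1 ∈ s.ω}, ENNReal.ofReal (chi1 w s p)
      ≤ ∫⁻ p in {p ∈ E | u p.1 ∈ s.ω}, ∑' j : ℕ, (s.box w (2 ^ j)).indicator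
          (fun _ => ENNReal.ofReal ((s.area w)⁻¹ * (16 * (1/16) ^ j))) p := by
        refine lintegral_mono fun p => ?_
        obtain ⟨j, hj, hle⟩ := exists_mem_box_chi1_le hw s p
        refine le_trans ?_ (ENNReal.le_tsum j)
        rw [indicator_of_mem hj]
        exact ENNReal.ofReal_le_ofReal hle
    _ = _ := by
        rw [lintegral_tsum fun j =>
          (measurable_const.indicator (s.measurableSet_box _)).aemeasurable]
        congr 1
        ext j
        rw [lintegral_indicator_const (s.measurableSet_box _),
          Measure.restrict_apply (s.measurableSet_box _)]
        congr 2
        ext p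
        simp only [Tile.dirBox, mem_inter_iff, mem_ofPred_eq]
        tauto

theorem ofReal_le_lintegral_of_le_dens {w : ℝ} (hw : 0 < w) {u : ℝ → ℝ} {E : Set (ℝ × ℝ)}
    {s : Tile} {δ : ℝ} (hδ : 0 < δ) (h : δ ≤ dens w u E s) :
    ENNReal.ofReal δ ≤ ∫⁻ p in {p ∈ E | u p.1 ∈ s.ω}, ENNReal.ofReal (chi1 w s p) := by
  have hint : IntegrableOn (chi1 w s) {p ∈ E | u p.1 ∈ s.ω} := by
    by_contra hn
    rw [dens, integral_undef hn] at h
    linarith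
  rw [← ofReal_integral_eq_lintegral_ofReal hint]
  · exact ENNReal.ofReal_le_ofReal h
  · exact Filter.Eventually.of_forall fun p =>
      mul_nonneg (inv_nonneg.2 (s.area_pos hw).le) (chi_nonneg _)

/-- Pigeonholing the tails of `χ`: a dense tile sees a large part of `E` at some dyadic scale. -/
theorem exists_le_volume_of_le_dens {w : ℝ} (hw : 0 < w) {u : ℝ → ℝ} {E : Set (ℝ × ℝ)}
    {s : Tile} {δ : ℝ} (hδ : 0 < δ) (h : δ ≤ dens w u E s) :
    ∃ j : ℕ, ENNReal.ofReal (δ / 64 * 8 ^ j) * ENNReal.ofReal (s.area w) ≤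
      volume (E ∩ s.dirBox w u (2 ^ j)) := by
  by_contra! hn
  have ha := s.area_pos hw
  have hle := (ofReal_le_lintegral_of_le_dens hw hδ h).trans (lintegral_chi1_le hw u E s)
  have hterm : ∀ j : ℕ, ENNReal.ofReal ((s.area w)⁻¹ * (16 * (1/16) ^ j)) *
      volume (E ∩ s.dirBox w u (2 ^ j)) ≤ ENNReal.ofReal (δ / 4 * (1/2) ^ j) := by
    intro j
    calc _ ≤ ENNReal.ofReal ((s.area w)⁻¹ * (16 * (1/16) ^ j)) *
          (ENNReal.ofReal (δ / 64 * 8 ^ j) * ENNReal.ofReal (s.area w)) := by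
          gcongr
          exact (hn j).le
      _ = _ := by
          rw [← ENNReal.ofReal_mul (by positivity), ← ENNReal.ofReal_mul (by positivity)]
          congr 1
          have h8 : (1/16 : ℝ) ^ j * 8 ^ j = (1/2) ^ j := by
            rw [← mul_pow]
            norm_num
          rw [← h8]
          field_simp
          ring
  have hsum : ∑' j : ℕ, ENNReal.ofReal (δ / 4 * (1/2) ^ j) = ENNReal.ofReal (δ / 2) := by
    rw [← ENNReal.ofReal_tsum_of_nonneg (fun j => by positivity)
      (summable_geometric_two.mul_left _), tsum_mul_left, tsum_geometric_two]
    congr 1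
    ring
  have := hle.trans ((ENNReal.tsum_le_tsum hterm).trans hsum.le)
  rw [ENNReal.ofReal_le_ofReal_iff (by positivity)] at this
  linarith

/-- the density lemma. -/
theorem density_lemma :
    ∃ C : ℝ, 0 < C ∧
      ∀ (w : ℝ), 0 < w →
      ∀ (u : ℝ → ℝ), Measurable u → (∀ x, |u x| ≤ 1) →
      ∀ (E : Set (ℝ × ℝ)), MeasurableSet E →
      ∀ (δ : ℝ), 0 < δ →
      ∀ ℛ : Finset Tile,
        (∀ R ∈ ℛ, ∀ R' ∈ ℛ, R ≠ R' → ¬ Tile.le w R R' ∧ ¬ Tile.le w R' R) →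
        (∀ R ∈ ℛ, δ ≤ dens w u E R) →
        ENNReal.ofReal (∑ R ∈ ℛ, R.area w) ≤
          ENNReal.ofReal C * volume E / ENNReal.ofReal δ := by
  refine ⟨12800, by norm_num, ?_⟩
  intro w hw u hu _ E _ δ hδ ℛ hinc hdens
  have hex : ∀ R : Tile, ∃ j : ℕ, R ∈ ℛ →
      ENNReal.ofReal (δ / 64 * 8 ^ j) * ENNReal.ofReal (R.area w) ≤
        volume (E ∩ R.dirBox w u (2 ^ j)) := by
    intro R
    by_cases hR : R ∈ ℛ
    · obtain ⟨j, hj⟩ := exists_le_volume_of_le_dens hw hδ (hdens R hR)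
      exact ⟨j, fun _ => hj⟩
    · exact ⟨0, fun h => absurd h hR⟩
  choose scale hscale using hex
  have hlayer : ∀ j : ℕ, ∑ R ∈ ℛ with scale R = j, ENNReal.ofReal (R.area w) ≤
      ENNReal.ofReal (6400 / δ * (1/2) ^ j) * volume E := by
    intro j
    have h := Tile.mul_sum_area_le hw (one_le_pow₀ one_le_two : (1 : ℝ) ≤ 2 ^ j) hu E
      (ENNReal.ofReal (δ / 64 * 8 ^ j)) {R ∈ ℛ | scale R = j}
      (fun R hR R' hR' => hinc R (Finset.mem_filter.1 hR).1 R' (Finset.mem_filter.1 hR').1)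
      (fun R hR => by
        obtain ⟨hmem, rfl⟩ := Finset.mem_filter.1 hR
        exact hscale R hmem)
    have hpos : 0 < δ / 64 * 8 ^ j := by positivity
    rw [← ENNReal.mul_le_mul_iff_right (ENNReal.ofReal_pos.2 hpos).ne' ENNReal.ofReal_ne_top]
    refine h.trans (le_of_eq ?_)
    rw [← mul_assoc, ← ENNReal.ofReal_mul hpos.le]
    congr 2
    have h8 : (8 : ℝ) ^ j * (1/2) ^ j = (2 ^ j) ^ 2 := by
      rw [← mul_pow, ← pow_mul, mul_comm j, pow_mul]
      norm_num
    rw [← h8]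
    field_simp
    ring
  have hsum : ∑' j : ℕ, ENNReal.ofReal (6400 / δ * (1/2) ^ j) = ENNReal.ofReal (12800 / δ) := by
    rw [← ENNReal.ofReal_tsum_of_nonneg (fun j => by positivity)
      (summable_geometric_two.mul_left _), tsum_mul_left, tsum_geometric_two]
    congr 1
    ring
  calc ENNReal.ofReal (∑ R ∈ ℛ, R.area w) = ∑ R ∈ ℛ, ENNReal.ofReal (R.area w) :=
        ENNReal.ofReal_sum_of_nonneg fun R _ => (R.area_pos hw).le
    _ = ∑ j ∈ ℛ.image scale, ∑ R ∈ ℛ with scale R = j, ENNReal.ofReal (R.area w) :=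
        (Finset.sum_fiberwise_of_maps_to (fun R hR => Finset.mem_image_of_mem scale hR) _).symm
    _ ≤ ∑ j ∈ ℛ.image scale, ENNReal.ofReal (6400 / δ * (1/2) ^ j) * volume E :=
        Finset.sum_le_sum fun j _ => hlayer j
    _ ≤ ∑' j : ℕ, ENNReal.ofReal (6400 / δ * (1/2) ^ j) * volume E := ENNReal.sum_le_tsum _
    _ = ENNReal.ofReal 12800 * volume E / ENNReal.ofReal δ := by
        rw [ENNReal.tsum_mul_right, hsum, ENNReal.ofReal_div_of_pos hδ, ENNReal.div_eq_inv_mul,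
          ENNReal.div_eq_inv_mul, mul_assoc]

end Bateman
end
end

section
/- [Band-limited averaging claim] There is an absolute constant C such that the following holds. Let h > 0 and let f ∈ L¹(ℝ²) be continuous with its Fourier transform supported in the horizontal band ℝ × [−4/h, 4/h]. Let I ⊂ ℝ be a bounded interval of positive length, y₀ ∈ ℝ, λ > 0, and for each integer k ≥ 0 let R_k = I × [y₀ − 2^k·h, y₀ + 2^k·h]. If (1/|R_k|)·∫_{R_k} |f| ≤ 2^{5k}·λ for every integer k ≥ 0, then (1/|I|)·∫_I |f(z, y₀)| dz ≤ C·λ. -/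
open MeasureTheory Set

noncomputable section

namespace Bateman

/-- The Fourier transform on `ℝ²`. -/
def fourierT (f : ℝ × ℝ → ℂ) (ξ : ℝ × ℝ) : ℂ :=
  ∫ x : ℝ × ℝ, Complex.exp (Complex.I * ((-(2 * Real.pi * (x.1 * ξ.1 + x.2 * ξ.2)) : ℝ) : ℂ)) * f x

open FourierTransform Real
open scoped SchwartzMap ContDiff ENNReal

lemma integral_fourier_mul_eq_of_integrable {f g : ℝ → ℂ} (hf : Integrable f) (hg : Integrable g) :
    ∫ ξ, 𝓕 f ξ * g ξ = ∫ x, f x * 𝓕 g x := by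
  have := VectorFourier.integral_fourierIntegral_smul_eq_flip (L := innerₗ ℝ)
      Real.continuous_fourierChar continuous_inner hf hg
  simpa using! this

lemma ae_eq_zero_of_fourier_eq_zero {f : ℝ → ℂ} (hf : Integrable f) (h : ∀ ξ, 𝓕 f ξ = 0) :
    ∀ᵐ x, f x = 0 := by
  apply ae_eq_zero_of_integral_contDiff_smul_eq_zero hf.locallyIntegrable
  intro g g_smooth g_cpt
  have hg₁ : HasCompactSupport (Complex.ofRealCLM ∘ g) := g_cpt.comp_left rfl
  have hg₂ : ContDiff ℝ ∞ (Complex.ofRealCLM ∘ g) := by fun_prop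
  set ψ : 𝓢(ℝ, ℂ) := hg₁.toSchwartzMap hg₂ with hψ
  have key := integral_fourier_mul_eq_of_integrable hf (𝓕⁻ ψ).integrable
  have h2 : 𝓕 ((𝓕⁻ ψ : 𝓢(ℝ, ℂ)) : ℝ → ℂ) = ψ := by
    rw [← SchwartzMap.fourier_coe, FourierTransform.fourier_fourierInv_eq]
  rw [h2] at key
  simp only [h, zero_mul, integral_zero] at key
  rw [key]
  congr 1 with x
  simp [hψ, mul_comm]

lemma continuous_fourier_of_integrable {f : ℝ → ℂ} (hf : Integrable f) : Continuous (𝓕 f) :=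
  VectorFourier.fourierIntegral_continuous Real.continuous_fourierChar
    (L := innerₗ ℝ) continuous_inner hf

lemma exists_schwartz_eq_one_on_Icc (r : ℝ) (hr : 0 < r) :
    ∃ b : 𝓢(ℝ, ℂ), ∀ x ∈ Icc (-r) r, b x = 1 := by
  let B : ContDiffBump (0 : ℝ) := ⟨r, r + 1, hr, by linarith⟩
  have hg₁ : HasCompactSupport (Complex.ofRealCLM ∘ B) := B.hasCompactSupport.comp_left rfl
  have hg₂ : ContDiff ℝ ∞ (Complex.ofRealCLM ∘ B) := by
    exact Complex.ofRealCLM.contDiff.comp B.contDiff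
  refine ⟨hg₁.toSchwartzMap hg₂, fun x hx => ?_⟩
  have : B x = 1 := B.one_of_mem_closedBall (by
    simpa [abs_le] using hx)
  simp [this]

lemma fourier_modulated_dilate (b : ℝ → ℂ) {h : ℝ} (hh : 0 < h) (y t : ℝ) :
    𝓕 (fun η : ℝ => b (h * η) * Complex.exp ((2 * π * (η * y) : ℝ) * Complex.I)) t =
      (h⁻¹ : ℝ) * 𝓕⁻ b ((y - t) / h) := by
  rw [fourier_real_eq_integral_exp_smul, fourierInv_eq']
  have := Measure.integral_comp_mul_left
    (fun s : ℝ => Complex.exp (((2 * π * inner ℝ s ((y - t) / h) : ℝ) : ℂ) * Complex.I) • b s) h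
  rw [abs_of_pos (inv_pos.2 hh), Complex.real_smul] at this
  rw [← this]
  congr 1 with η
  simp only [smul_eq_mul]
  rw [mul_left_comm, ← Complex.exp_add, mul_comm]
  congr 2
  simp only [RCLike.inner_apply, conj_trivial]
  push_cast
  have : (h : ℂ) ≠ 0 := by exact_mod_cast hh.ne'
  field_simp
  ring

lemma reproducing_formula {b : 𝓢(ℝ, ℂ)} {r : ℝ} (hb : ∀ x ∈ Icc (-r) r, b x = 1)
    {h : ℝ} (hh : 0 < h) {g : ℝ → ℂ} (hgc : Continuous g) (hgi : Integrable g)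
    (hg : ∀ η, η ∉ Icc (-(r / h)) (r / h) → 𝓕 g η = 0) (y : ℝ) :
    g y = ∫ t, g t * ((h⁻¹ : ℝ) * (𝓕⁻ b) ((y - t) / h)) := by
  have hFi : Integrable (𝓕 g) := by
    apply (continuous_fourier_of_integrable hgi).integrable_of_hasCompactSupport
    exact HasCompactSupport.intro isCompact_Icc hg
  have hk : Integrable
      (fun η : ℝ => b (h * η) * Complex.exp ((2 * π * (η * y) : ℝ) * Complex.I)) := by
    refine (b.integrable.comp_mul_left' hh.ne').mul_bdd (c := 1) ?_ ?_
    · fun_prop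
    · exact .of_forall fun η => (Complex.norm_exp_ofReal_mul_I _).le
  have key := integral_fourier_mul_eq_of_integrable hgi hk
  simp_rw [fourier_modulated_dilate b hh y, ← SchwartzMap.fourierInv_coe] at key
  rw [← key]
  conv_lhs => rw [← Continuous.fourierInv_fourier_eq hgc hgi hFi, fourierInv_eq']
  congr 1 with η
  by_cases hη : η ∈ Icc (-(r / h)) (r / h)
  · rw [hb (h * η)]
    · simp [mul_comm]
    · rw [mem_Icc, ← neg_div, div_le_iff₀ hh, le_div_iff₀ hh] at hη
      rwa [mem_Icc, mul_comm]
  · simp [hg η hη]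

lemma schwartz_enorm_le_tsum (φ : 𝓢(ℝ, ℂ)) :
    ∃ C : ℝ, 0 < C ∧ ∀ s, ‖φ s‖ₑ ≤ ∑' k : ℕ, ENNReal.ofReal (C * (2 ^ (7 * k))⁻¹) *
      (Icc (-2 ^ k) (2 ^ k)).indicator 1 s := by
  obtain ⟨A, hA, hA'⟩ := φ.decay 0 0
  obtain ⟨D, hD, hD'⟩ := φ.decay 7 0
  simp only [norm_iteratedFDeriv_zero, pow_zero, one_mul] at hA' hD'
  refine ⟨A + 128 * D, by positivity, fun s => ?_⟩
  suffices ∃ k : ℕ, |s| ≤ 2 ^ k ∧ ‖φ s‖ ≤ (A + 128 * D) * (2 ^ (7 * k))⁻¹ by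
    obtain ⟨k, hk, hk'⟩ := this
    refine le_trans ?_ (ENNReal.le_tsum k)
    rw [indicator_of_mem (by simpa [abs_le] using hk), Pi.one_apply, mul_one,
      ← ofReal_norm]
    exact ENNReal.ofReal_le_ofReal hk'
  have hex : ∃ k : ℕ, |s| ≤ 2 ^ k := (pow_unbounded_of_one_lt |s| one_lt_two).imp fun _ => le_of_lt
  classical
  refine ⟨Nat.find hex, Nat.find_spec hex, ?_⟩
  rcases hn : Nat.find hex with _ | n
  · simpa using (hA' s).trans (by linarith)
  · have hlt : 2 ^ n < |s| := not_le.1 (Nat.find_min hex (by omega))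
    have h1 : ((2 : ℝ) ^ n) ^ 7 * ‖φ s‖ ≤ D := by
      refine le_trans ?_ (hD' s)
      rw [Real.norm_eq_abs]
      gcongr
    rw [← div_eq_mul_inv, le_div_iff₀ (by positivity)]
    have : (2 : ℝ) ^ (7 * (n + 1)) = 128 * (2 ^ n) ^ 7 := by ring
    rw [this]
    nlinarith

lemma ae_fourier_slice_eq_zero {f : ℝ × ℝ → ℂ} (hf : Integrable f) {η : ℝ}
    (hη : ∀ ξ : ℝ, fourierT f (ξ, η) = 0) :
    ∀ᵐ z : ℝ, 𝓕 (fun y => f (z, y)) η = 0 := by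
  have hmod : ∀ ξ : ℝ, Integrable (fun p : ℝ × ℝ =>
      Complex.exp (Complex.I * ((-(2 * Real.pi * (p.1 * ξ + p.2 * η)) : ℝ) : ℂ)) * f p) := by
    intro ξ
    refine hf.bdd_mul (c := 1) ?_ ?_
    · fun_prop
    · refine .of_forall fun p => ?_
      rw [mul_comm]
      exact (Complex.norm_exp_ofReal_mul_I _).le
  apply ae_eq_zero_of_fourier_eq_zero
  · have := (hmod 0).integral_prod_left
    convert this using 2 with z
    rw [fourier_real_eq_integral_exp_smul]
    congr 1 with y
    rw [smul_eq_mul]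
    congr 2
    push_cast
    ring
  · intro ξ
    rw [← hη ξ, fourierT, Measure.volume_eq_prod, integral_prod _ (hmod ξ),
      fourier_real_eq_integral_exp_smul]
    congr 1 with z
    rw [fourier_real_eq_integral_exp_smul, smul_eq_mul, ← integral_const_mul]
    congr 1 with y
    rw [smul_eq_mul, ← mul_assoc, ← Complex.exp_add]
    congr 2
    push_cast
    ring

lemma ae_fourier_slice_eq_zero_off_band {f : ℝ × ℝ → ℂ} (hf : Integrable f) {r : ℝ}
    (hband : ∀ ξ : ℝ × ℝ, ξ.2 ∉ Icc (-r) r → fourierT f ξ = 0) :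
    ∀ᵐ z : ℝ, ∀ η, η ∉ Icc (-r) r → 𝓕 (fun y => f (z, y)) η = 0 := by
  have hrat : ∀ᵐ z : ℝ, ∀ q : ℚ, (q : ℝ) ∉ Icc (-r) r → 𝓕 (fun y => f (z, y)) q = 0 := by
    rw [ae_all_iff]
    intro q
    by_cases hq : (q : ℝ) ∈ Icc (-r) r
    · exact .of_forall fun z h => absurd hq h
    · filter_upwards [ae_fourier_slice_eq_zero hf fun ξ => hband (ξ, q) hq] with z hz _ using hz
  filter_upwards [hrat, hf.prod_right_ae] with z hz hzi η hη
  have hopen : IsOpen (Icc (-r) r)ᶜ := isClosed_Icc.isOpen_compl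
  have hdense := Rat.denseRange_cast (𝕜 := ℝ) |>.open_subset_closure_inter hopen
  have hclosed : IsClosed {η : ℝ | 𝓕 (fun y => f (z, y)) η = 0} :=
    isClosed_eq (continuous_fourier_of_integrable hzi) continuous_const
  refine closure_minimal ?_ hclosed (hdense hη)
  rintro _ ⟨hq, q, rfl⟩
  exact hz q hq

lemma enorm_rescaled_le_tsum {φ : ℝ → ℂ} {C : ℝ} (hC : 0 ≤ C)
    (hφ : ∀ s, ‖φ s‖ₑ ≤ ∑' k : ℕ, ENNReal.ofReal (C * (2 ^ (7 * k))⁻¹) *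
      (Icc (-2 ^ k) (2 ^ k)).indicator 1 s)
    {h : ℝ} (hh : 0 < h) (y t : ℝ) :
    ‖((h⁻¹ : ℝ) : ℂ) * φ ((y - t) / h)‖ₑ ≤
      ∑' k : ℕ, ENNReal.ofReal (C * (2 ^ (7 * k))⁻¹ * h⁻¹) *
        (Icc (y - 2 ^ k * h) (y + 2 ^ k * h)).indicator 1 t := by
  have hh' : ‖((h⁻¹ : ℝ) : ℂ)‖ₑ = ENNReal.ofReal h⁻¹ := by
    rw [← ofReal_norm, Complex.norm_real, Real.norm_of_nonneg (by positivity)]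
  rw [enorm_mul, hh']
  refine (mul_le_mul_right (hφ _) _).trans_eq ?_
  rw [← ENNReal.tsum_mul_left]
  congr 1 with k
  have hmem : (y - t) / h ∈ Icc (-2 ^ k : ℝ) (2 ^ k) ↔
      t ∈ Icc (y - 2 ^ k * h) (y + 2 ^ k * h) := by
    rw [mem_Icc, mem_Icc, le_div_iff₀ hh, div_le_iff₀ hh]
    constructor <;> rintro ⟨h1, h2⟩ <;> constructor <;> linarith
  rw [ENNReal.ofReal_mul (q := h⁻¹) (by positivity), ← mul_assoc,
    mul_comm (ENNReal.ofReal h⁻¹)]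
  congr 1
  by_cases ht : t ∈ Icc (y - 2 ^ k * h) (y + 2 ^ k * h)
  · rw [indicator_of_mem ht, indicator_of_mem (hmem.2 ht), Pi.one_apply, Pi.one_apply]
  · rw [indicator_of_notMem ht, indicator_of_notMem (mt hmem.1 ht)]

lemma enorm_le_tsum_of_eq_convolution {φ : ℝ → ℂ} {C : ℝ} (hC : 0 ≤ C)
    (hφ : ∀ s, ‖φ s‖ₑ ≤ ∑' k : ℕ, ENNReal.ofReal (C * (2 ^ (7 * k))⁻¹) *
      (Icc (-2 ^ k) (2 ^ k)).indicator 1 s)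
    {h : ℝ} (hh : 0 < h) {g : ℝ → ℂ} (hg : Measurable g) {y : ℝ}
    (hy : g y = ∫ t, g t * ((h⁻¹ : ℝ) * φ ((y - t) / h))) :
    ‖g y‖ₑ ≤ ∑' k : ℕ, ENNReal.ofReal (C * (2 ^ (7 * k))⁻¹ * h⁻¹) *
      ∫⁻ t in Icc (y - 2 ^ k * h) (y + 2 ^ k * h), ‖g t‖ₑ := by
  rw [hy]
  refine (enorm_integral_le_lintegral_enorm _).trans ?_
  have hm : Measurable fun t => ‖g t‖ₑ := hg.enorm
  have hpt : ∀ t, ‖g t * ((h⁻¹ : ℝ) * φ ((y - t) / h))‖ₑ ≤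
      ∑' k : ℕ, ENNReal.ofReal (C * (2 ^ (7 * k))⁻¹ * h⁻¹) *
        (Icc (y - 2 ^ k * h) (y + 2 ^ k * h)).indicator (fun t => ‖g t‖ₑ) t := by
    intro t
    rw [enorm_mul]
    refine (mul_le_mul_right (enorm_rescaled_le_tsum hC hφ hh y t) _).trans_eq ?_
    rw [← ENNReal.tsum_mul_left]
    congr 1 with k
    rw [mul_left_comm]
    congr 1
    by_cases ht : t ∈ Icc (y - 2 ^ k * h) (y + 2 ^ k * h)
    · rw [indicator_of_mem ht, indicator_of_mem ht, Pi.one_apply, mul_one]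
    · rw [indicator_of_notMem ht, indicator_of_notMem ht, mul_zero]
  refine (lintegral_mono hpt).trans_eq ?_
  rw [lintegral_tsum fun k =>
    ((hm.indicator measurableSet_Icc).const_mul _).aemeasurable]
  congr 1 with k
  rw [lintegral_const_mul _ (hm.indicator measurableSet_Icc),
    lintegral_indicator measurableSet_Icc]

/-- the band-limited averaging claim.  If `f ∈ L¹(ℝ²)` is continuous with
Fourier transform supported in the horizontal band `ℝ × [−4/h, 4/h]`, `I = [a,b]`, and
the averages of `|f|` over the rectangles `R_k = I × [y₀ − 2^k h, y₀ + 2^k h]` are at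
most `2^{5k}·λ`, then the average of `|f(·, y₀)|` over `I` is at most `C·λ`. -/
theorem band_limited_averaging :
    ∃ C : ℝ, 0 < C ∧
      ∀ (h : ℝ), 0 < h →
      ∀ f : ℝ × ℝ → ℂ, Continuous f → Integrable f volume →
        (∀ ξ : ℝ × ℝ, ξ.2 ∉ Icc (-(4 / h)) (4 / h) → fourierT f ξ = 0) →
      ∀ a b : ℝ, a < b →
      ∀ y₀ lam : ℝ, 0 < lam →
        (∀ k : ℕ,
          ((b - a) * (2 * 2 ^ k * h))⁻¹ *
              ∫ q in Icc a b ×ˢ Icc (y₀ - 2 ^ k * h) (y₀ + 2 ^ k * h), ‖f q‖ ≤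
            2 ^ (5 * k) * lam) →
        (b - a)⁻¹ * ∫ z in Icc a b, ‖f (z, y₀)‖ ≤ C * lam := by
  obtain ⟨β, hβ⟩ := exists_schwartz_eq_one_on_Icc 4 (by norm_num)
  obtain ⟨C, hC, hCφ⟩ := schwartz_enorm_le_tsum (𝓕⁻ β)
  refine ⟨4 * C, by positivity, ?_⟩
  intro h hh f hfc hfi hband a b hab y₀ lam hlam hR
  have hba : 0 < b - a := sub_pos.2 hab
  have hpt : ∀ᵐ z : ℝ, ‖f (z, y₀)‖ₑ ≤ ∑' k : ℕ, ENNReal.ofReal (C * (2 ^ (7 * k))⁻¹ * h⁻¹) *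
      ∫⁻ t in Icc (y₀ - 2 ^ k * h) (y₀ + 2 ^ k * h), ‖f (z, t)‖ₑ := by
    filter_upwards [ae_fourier_slice_eq_zero_off_band hfi hband, hfi.prod_right_ae] with z hz hzi
    have hslice : Continuous fun y => f (z, y) := by fun_prop
    have hrep := reproducing_formula hβ hh hslice hzi hz y₀
    exact enorm_le_tsum_of_eq_convolution hC.le hCφ hh hslice.measurable hrep
  have hrect : ∀ k : ℕ, ∫⁻ z in Icc a b, ∫⁻ t in Icc (y₀ - 2 ^ k * h) (y₀ + 2 ^ k * h),
      ‖f (z, t)‖ₑ ≤ ENNReal.ofReal (2 ^ (5 * k) * lam * ((b - a) * (2 * 2 ^ k * h))) := by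
    intro k
    have hmeas : Measurable fun p : ℝ × ℝ => ‖f p‖ₑ := hfc.measurable.enorm
    rw [← lintegral_prod (fun p : ℝ × ℝ => ‖f p‖ₑ) hmeas.aemeasurable, Measure.prod_restrict,
      ← Measure.volume_eq_prod, ← ofReal_integral_norm_eq_lintegral_enorm hfi.restrict]
    apply ENNReal.ofReal_le_ofReal
    exact ((inv_mul_le_iff₀ (by positivity)).1 (hR k)).trans_eq (mul_comm _ _)
  have hgeom : ∀ k : ℕ, C * (2 ^ (7 * k))⁻¹ * h⁻¹ *
      (2 ^ (5 * k) * lam * ((b - a) * (2 * 2 ^ k * h))) =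
        2 * C * lam * (b - a) * (1 / 2) ^ k := by
    intro k
    rw [show 7 * k = 5 * k + k + k by ring, pow_add, pow_add, one_div, inv_pow]
    field_simp
  have hslice : Continuous fun z => f (z, y₀) := by fun_prop
  have hbound : ∫⁻ z in Icc a b, ‖f (z, y₀)‖ₑ ≤ ENNReal.ofReal (4 * C * lam * (b - a)) := by
    calc ∫⁻ z in Icc a b, ‖f (z, y₀)‖ₑ
        ≤ ∫⁻ z in Icc a b, ∑' k : ℕ, ENNReal.ofReal (C * (2 ^ (7 * k))⁻¹ * h⁻¹) *
            ∫⁻ t in Icc (y₀ - 2 ^ k * h) (y₀ + 2 ^ k * h), ‖f (z, t)‖ₑ :=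
          lintegral_mono_ae (ae_restrict_of_ae hpt)
      _ = ∑' k : ℕ, ENNReal.ofReal (C * (2 ^ (7 * k))⁻¹ * h⁻¹) * ∫⁻ z in Icc a b,
            ∫⁻ t in Icc (y₀ - 2 ^ k * h) (y₀ + 2 ^ k * h), ‖f (z, t)‖ₑ := by
          have hm : ∀ k : ℕ, Measurable fun z =>
              ∫⁻ t in Icc (y₀ - 2 ^ k * h) (y₀ + 2 ^ k * h), ‖f (z, t)‖ₑ := fun k =>
            Measurable.lintegral_prod_right' (f := fun p : ℝ × ℝ => ‖f p‖ₑ)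
              hfc.measurable.enorm
          rw [lintegral_tsum fun k => ((hm k).const_mul _).aemeasurable]
          congr 1 with k
          rw [lintegral_const_mul _ (hm k)]
      _ ≤ ∑' k : ℕ, ENNReal.ofReal (2 * C * lam * (b - a) * (1 / 2) ^ k) := by
          refine ENNReal.tsum_le_tsum fun k => ?_
          rw [← hgeom, ENNReal.ofReal_mul (p := C * (2 ^ (7 * k))⁻¹ * h⁻¹) (by positivity)]
          exact mul_le_mul_right (hrect k) _
      _ = _ := by
          rw [← ENNReal.ofReal_tsum_of_nonneg (fun k => by positivity)
            (summable_geometric_two.mul_left _), tsum_mul_left, tsum_geometric_two]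
          congr 1
          ring
  rw [inv_mul_le_iff₀ hba, integral_norm_eq_lintegral_enorm hslice.aestronglyMeasurable]
  refine ENNReal.toReal_le_of_le_ofReal (by positivity) (hbound.trans_eq ?_)
  congr 1
  ring

end Bateman
end
end
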